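/- arXiv:2402.06478 — 2 statements merged into one kernel-verified Lean document; each statement's English description precedes it below -/
import Mathlib

section
/- Suppose C is a closed curve on the Riemann sphere composed of finitely many horizontal and/or vertical trajectory arcs of a meromorphic quadratic differential, with vertices z_j of multiplicities n_j and interior angles θ_j, enclosing interior critical points of multiplicities m_i. Then Teichmüller's equality Σ_j (1 - (n_j+2)θ_j/(2π)) = 2 + Σ_i m_i implies: a quadratic differential of the form -e^{2iθ}(z-a)(z²-1)dz² with a ∉ {±1} has at most two short trajectories connecting two different pairs of distinct finite critical points. -/
open Complex Set

noncomputable section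

/-- The coefficient of the quadratic differential `ϖ_{a,θ} = -e^{2iθ}(z-a)(z²-1) dz²`. -/
def varpi (θ : ℝ) (a z : ℂ) : ℂ :=
  -Complex.exp (2 * Complex.I * θ) * (z - a) * (z ^ 2 - 1)

/-- `u` and `v` are connected by a short (finite critical) horizontal trajectory of
`ϖ_{a,θ}`: a curve from `u` to `v`, passing only through regular points in between,
along which `ϖ_{a,θ}(γ(t)) γ'(t)² > 0`. -/
def ShortTraj (θ : ℝ) (a u v : ℂ) : Prop :=
  ∃ γ γ' : ℝ → ℂ,
    ContinuousOn γ (Icc (0:ℝ) 1) ∧ γ 0 = u ∧ γ 1 = v ∧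
    ∀ t ∈ Ioo (0:ℝ) 1,
      HasDerivAt γ (γ' t) t ∧ γ' t ≠ 0 ∧
      (γ t - a) * ((γ t) ^ 2 - 1) ≠ 0 ∧
      (varpi θ a (γ t) * (γ' t) ^ 2).im = 0 ∧
      0 < (varpi θ a (γ t) * (γ' t) ^ 2).re

lemma arg_rigid {X : Type*} [TopologicalSpace X] {s : Set X} (hs : IsPreconnected s) {f : X → ℝ}
    (hf : ContinuousOn f s) {c : ℂ} (h : ∀ x ∈ s, Complex.exp (f x * I) = c) :
    ∀ x ∈ s, ∀ y ∈ s, f x = f y := by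
  intro x hx y hy
  have hcon : IsPreconnected ((fun z => (f z - f x) / (2 * Real.pi)) '' s) :=
    hs.image _ ((hf.sub continuousOn_const).div_const _)
  have hint : ∀ z ∈ s, ∃ n : ℤ, (f z - f x) / (2 * Real.pi) = n := by
    intro z hz
    have := (h z hz).trans (h x hx).symm
    rw [Complex.exp_eq_exp_iff_exists_int] at this
    obtain ⟨n, hn⟩ := this
    refine ⟨n, ?_⟩
    have h2 : (f z : ℂ) = f x + n * (2 * Real.pi) := by
      have hI : (I : ℂ) ≠ 0 := I_ne_zero
      apply mul_right_cancel₀ hI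
      rw [hn]; ring
    have h3 : f z = f x + n * (2 * Real.pi) := by exact_mod_cast h2
    rw [h3]; field_simp; ring
  have htd : IsTotallyDisconnected (Set.range (fun n : ℤ => (n : ℝ))) :=
    (Set.countable_range _).isTotallyDisconnected
  have := htd _ (by rintro _ ⟨z, hz, rfl⟩; obtain ⟨n, hn⟩ := hint z hz; exact ⟨n, hn.symm⟩) hcon
    ⟨x, hx, rfl⟩ ⟨y, hy, rfl⟩
  simp only [sub_self, zero_div] at this
  have hpi := Real.pi_pos
  have := (div_eq_zero_iff.1 this.symm).resolve_right (by positivity)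
  linarith

lemma lift_arg {E : Type*} [NormedAddCommGroup E] [NormedSpace ℝ E] {s : Set E} (hs : Convex ℝ s)
    {f : E → ℂ} (hf : ContinuousOn f s) (h0 : ∀ x ∈ s, f x ≠ 0) :
    ∃ φ : E → ℝ, ContinuousOn φ s ∧ ∀ x ∈ s, f x = ‖f x‖ * Complex.exp (φ x * I) := by
  rcases s.eq_empty_or_nonempty with rfl | ⟨x0, hx0⟩
  · exact ⟨fun _ => 0, by simp, by simp⟩
  have hmem : ∀ (t : unitInterval) (x : s), x0 + (t : ℝ) • ((x : E) - x0) ∈ s := by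
    intro t x
    exact hs.add_smul_sub_mem hx0 x.2 ⟨t.2.1, t.2.2⟩
  let H : C(unitInterval × s, {z : ℂ // z ≠ 0}) :=
    ⟨fun p => ⟨f (x0 + (p.1 : ℝ) • ((p.2 : E) - x0)), h0 _ (hmem p.1 p.2)⟩, by
      refine Continuous.subtype_mk ?_ _
      exact hf.comp_continuous (by fun_prop) (fun p => hmem p.1 p.2)⟩
  let g : C(s, ℂ) := ContinuousMap.const _ (Complex.log (f x0))
  have H0 : ∀ a, H (0, a) = (fun z : ℂ ↦ (⟨_, z.exp_ne_zero⟩ : {z : ℂ // z ≠ 0})) (g a) := by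
    intro a
    apply Subtype.ext
    simp [H, g, Complex.exp_log (h0 x0 hx0)]
  let K := Complex.isCoveringMap_exp.liftHomotopy H g H0
  have hK := Complex.isCoveringMap_exp.liftHomotopy_lifts H g H0
  have hc : Continuous (fun x : s => (K (1, x)).im) := by fun_prop
  classical
  refine ⟨fun x => if hx : x ∈ s then (K (1, ⟨x, hx⟩)).im else 0, ?_, ?_⟩
  · rw [continuousOn_iff_continuous_domRestrict]
    convert hc using 2 with x
    simp
  · intro x hx
    have h1 := congrArg Subtype.val (congrFun hK (1, ⟨x, hx⟩))
    simp only [H, Function.comp] at h1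
    have h2 : Complex.exp (K (1, ⟨x, hx⟩)) = f x := by
      rw [h1]; simp
    simp only [hx, dif_pos]
    rw [← h2, Complex.norm_exp]
    conv_lhs => rw [← Complex.re_add_im (K (1, ⟨x, hx⟩))]
    rw [Complex.exp_add]; push_cast; rfl

lemma exp_of_lift {z w : ℂ} {x y : ℝ} (hz : z = ‖z‖ * Complex.exp (x * I))
    (hw : w = ‖w‖ * Complex.exp (y * I)) (h0 : z ≠ 0) {r : ℂ} (hr : w = r * z) :
    Complex.exp ((y - x : ℝ) * I) = r / ‖r‖ ∨ r = 0 := by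
  by_cases hr0 : r = 0
  · exact Or.inr hr0
  left
  have h1 : (‖z‖ : ℂ) ≠ 0 := by simpa using h0
  have h2 : (‖r‖ : ℂ) ≠ 0 := by simpa using hr0
  have h3 : (‖r‖ : ℂ) * Complex.exp (y * I) = r * Complex.exp (x * I) := by
    apply mul_left_cancel₀ h1
    have : w = ‖r‖ * ‖z‖ * Complex.exp (y * I) := by
      conv_lhs => rw [hw, hr, norm_mul]
      push_cast; ring
    calc (‖z‖ : ℂ) * (‖r‖ * Complex.exp (y * I)) = w := by rw [this]; ring
      _ = r * z := hr
      _ = r * (‖z‖ * Complex.exp (x * I)) := by rw [← hz]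
      _ = _ := by ring
  rw [show (((y - x : ℝ) : ℂ) * I) = y * I - x * I by push_cast; ring, Complex.exp_sub]
  have := Complex.exp_ne_zero (x * I)
  rw [div_eq_div_iff this h2]
  linear_combination h3

/-- total variation of the argument of `f` along `[0,1]` equals `x` -/
def VarArg (f : ℝ → ℂ) (x : ℝ) : Prop :=
  ∃ φ : ℝ → ℝ, ContinuousOn φ (Icc 0 1) ∧
    (∀ t ∈ Icc (0:ℝ) 1, f t = ‖f t‖ * Complex.exp (φ t * I)) ∧ φ 1 - φ 0 = x

/-- two lifts along a preconnected set differ by a constant if the functions are proportional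
with constant ratio direction. -/
lemma lift_diff_const {X : Type*} [TopologicalSpace X] {s : Set X} (hs : IsPreconnected s)
    {f g : X → ℂ} {φ ψ : X → ℝ} (hφ : ContinuousOn φ s) (hψ : ContinuousOn ψ s)
    (hf : ∀ x ∈ s, f x = ‖f x‖ * Complex.exp (φ x * I))
    (hg : ∀ x ∈ s, g x = ‖g x‖ * Complex.exp (ψ x * I))
    (f0 : ∀ x ∈ s, f x ≠ 0) {c : ℂ} (hc : c ≠ 0)
    (h : ∀ x ∈ s, ∃ r : ℝ, 0 < r ∧ g x = (r * c) * f x) :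
    ∀ x ∈ s, ∀ y ∈ s, ψ x - φ x = ψ y - φ y := by
  refine arg_rigid hs (hψ.sub hφ) (c := c / ‖c‖) ?_
  intro x hx
  obtain ⟨r, hr, h'⟩ := h x hx
  have hr' : (r : ℂ) ≠ 0 := by exact_mod_cast hr.ne'
  rcases exp_of_lift (hf x hx) (hg x hx) (f0 x hx) h' with h1 | h1
  · rw [h1, norm_mul]
    simp only [Complex.norm_real, Real.norm_eq_abs, abs_of_pos hr]
    push_cast
    rw [mul_div_mul_left _ _ hr']
  · exact absurd h1 (mul_ne_zero hr' hc)

lemma VarArg.exists {f : ℝ → ℂ} (hf : ContinuousOn f (Icc 0 1)) (h0 : ∀ x ∈ Icc (0:ℝ) 1, f x ≠ 0) :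
    ∃ x, VarArg f x := by
  obtain ⟨φ, h1, h2⟩ := lift_arg (convex_Icc (0:ℝ) 1) hf h0
  exact ⟨_, φ, h1, h2, rfl⟩

def tri : Set (ℝ × ℝ) := {p | 0 ≤ p.1 ∧ p.1 ≤ p.2 ∧ p.2 ≤ 1}

lemma convex_tri : Convex ℝ tri := by
  intro x hx y hy a b ha hb hab
  obtain ⟨h1, h2, h3⟩ := hx
  obtain ⟨k1, k2, k3⟩ := hy
  refine ⟨?_, ?_, ?_⟩ <;> simp only [Prod.fst_add, Prod.snd_add, Prod.smul_fst, Prod.smul_snd, smul_eq_mul]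
  · positivity
  · nlinarith
  · nlinarith

lemma lemmaA {c P Q R : ℂ} {γ : ℝ → ℂ} (hc : c ≠ 0)
    (h0 : γ 0 = P) (h1 : γ 1 = Q)
    (hP : ∀ t ∈ Ioo (0:ℝ) 1, γ t ≠ P) (hQ : ∀ t ∈ Ioo (0:ℝ) 1, γ t ≠ Q)
    (hR : ∀ t ∈ Icc (0:ℝ) 1, γ t ≠ R)
    {U : ℝ × ℝ → ℂ} (hU : ContinuousOn U tri) (hU1 : ∀ p ∈ tri, ‖U p‖ = 1)
    (hUs : ∀ s t, 0 ≤ s → s < t → t ≤ 1 → γ t - γ s = ‖γ t - γ s‖ * U (s, t))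
    (hUd : ∀ t ∈ Ioo (0:ℝ) 1, ∃ r : ℝ, 0 < r ∧
      U (t, t) ^ 2 * (c * (γ t - P) * (γ t - Q) * (γ t - R)) = r)
    {a b d : ℝ} (ha : VarArg (fun t => U (0, t)) a) (hb : VarArg (fun t => U (t, 1)) b)
    (hd : VarArg (fun t => γ t - R) d) :
    3 * (a + b) = - d ∧ Complex.exp ((a + b : ℝ) * I) * U (0, 0) = U (1, 1) := by
  have hU0 : ∀ p ∈ tri, U p ≠ 0 := fun p hp h => by
    have := hU1 p hp; rw [h] at this; simp at this
  have mem0 : ∀ t ∈ Icc (0:ℝ) 1, ((0:ℝ), t) ∈ tri := fun t ht => ⟨le_rfl, ht.1, ht.2⟩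
  have mem1 : ∀ t ∈ Icc (0:ℝ) 1, (t, (1:ℝ)) ∈ tri := fun t ht => ⟨ht.1, ht.2, le_rfl⟩
  have memd : ∀ t ∈ Icc (0:ℝ) 1, (t, t) ∈ tri := fun t ht => ⟨ht.1, le_rfl, ht.2⟩
  obtain ⟨φ, hφc, hφ⟩ := lift_arg convex_tri hU hU0
  obtain ⟨α, hαc, hα, ha⟩ := ha
  obtain ⟨β, hβc, hβ, hb⟩ := hb
  obtain ⟨χ, hχc, hχ, hd⟩ := hd
  have c0 : ContinuousOn (fun t : ℝ => φ (0, t)) (Icc 0 1) :=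
    hφc.comp (by fun_prop) mem0
  have c1 : ContinuousOn (fun t : ℝ => φ (t, 1)) (Icc 0 1) :=
    hφc.comp (by fun_prop) mem1
  have cd : ContinuousOn (fun t : ℝ => φ (t, t)) (Icc 0 1) :=
    hφc.comp (by fun_prop) memd
  have i0 : (0:ℝ) ∈ Icc (0:ℝ) 1 := by simp
  have i1 : (1:ℝ) ∈ Icc (0:ℝ) 1 := by simp
  have ea := lift_diff_const isPreconnected_Icc c0 hαc (f := fun t => U (0, t))
    (fun t ht => hφ _ (mem0 t ht)) hα (fun t ht => hU0 _ (mem0 t ht)) (c := 1) one_ne_zero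
    (fun t ht => ⟨1, one_pos, by simp⟩) 1 i1 0 i0
  have eb := lift_diff_const isPreconnected_Icc c1 hβc (f := fun t => U (t, 1))
    (fun t ht => hφ _ (mem1 t ht)) hβ (fun t ht => hU0 _ (mem1 t ht)) (c := 1) one_ne_zero
    (fun t ht => ⟨1, one_pos, by simp⟩) 1 i1 0 i0
  have hD : a + b = φ (1, 1) - φ (0, 0) := by linarith
  constructor
  · -- rigidity on the open interval, then closure
    let f : ℝ → ℝ := fun t => 2 * φ (t, t) + φ (0, t) + φ (t, 1) + χ t
    have fc : ContinuousOn f (Icc 0 1) :=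
      ((((continuousOn_const.mul cd).add c0).add c1).add hχc)
    have key : ∀ t ∈ Ioo (0:ℝ) 1, Complex.exp (f t * I) = - ‖c‖ / c := by
      intro t ht
      have ht' : t ∈ Icc (0:ℝ) 1 := Ioo_subset_Icc_self ht
      obtain ⟨r, hr, hr'⟩ := hUd t ht
      have e1 := hφ _ (mem0 t ht')
      have e2 := hφ _ (mem1 t ht')
      have e3 := hφ _ (memd t ht')
      have e4 : γ t - R = ‖γ t - R‖ * Complex.exp (χ t * I) := hχ t ht'
      rw [hU1 _ (mem0 t ht')] at e1
      rw [hU1 _ (mem1 t ht')] at e2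
      rw [hU1 _ (memd t ht')] at e3
      have f1 := hUs 0 t le_rfl ht.1 ht.2.le
      have f2 := hUs t 1 ht.1.le ht.2 le_rfl
      rw [h0] at f1
      rw [h1] at f2
      simp only [Complex.ofReal_one, one_mul] at e1 e2 e3
      have n1 : 0 < ‖γ t - P‖ := norm_pos_iff.2 (sub_ne_zero.2 (hP t ht))
      have n2 : 0 < ‖Q - γ t‖ := norm_pos_iff.2 (sub_ne_zero.2 (hQ t ht).symm)
      have n3 : 0 < ‖γ t - R‖ := norm_pos_iff.2 (sub_ne_zero.2 (hR t ht'))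
      have E : Complex.exp (f t * I) = Complex.exp (φ (t,t) * I) ^ 2 * Complex.exp (φ (0,t) * I)
          * Complex.exp (φ (t,1) * I) * Complex.exp (χ t * I) := by
        rw [← Complex.exp_nat_mul, ← Complex.exp_add, ← Complex.exp_add, ← Complex.exp_add]
        congr 1; simp only [f]; push_cast; ring
      set N := ‖γ t - P‖ * ‖Q - γ t‖ * ‖γ t - R‖ with hN
      have hNpos : 0 < N := by positivity
      have M : Complex.exp (f t * I) * (-(N * c)) = r := by
        rw [← hr', E, ← e1, ← e2, ← e3]
        have : γ t - Q = - (Q - γ t) := by ring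
        rw [this, f1, f2, e4, hN]
        push_cast; ring
      have nE : ‖Complex.exp (f t * I)‖ = 1 := Complex.norm_exp_ofReal_mul_I _
      have M2 : N * ‖c‖ = r := by
        have := congrArg norm M
        rw [norm_mul, nE, norm_neg, norm_mul] at this
        simpa [abs_of_pos hr, abs_of_pos hNpos] using this
      have hN0 : (N : ℂ) ≠ 0 := by exact_mod_cast hNpos.ne'
      rw [eq_div_iff hc]
      apply mul_left_cancel₀ hN0
      have : (r : ℂ) = N * ‖c‖ := by exact_mod_cast M2.symm
      rw [this] at M
      linear_combination -M
    have const := arg_rigid isPreconnected_Ioo (fc.mono Ioo_subset_Icc_self) key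
    have h2 : (1/2 : ℝ) ∈ Ioo (0:ℝ) 1 := by norm_num
    have all : ∀ t ∈ Icc (0:ℝ) 1, f t = f (1/2) := by
      have : EqOn f (fun _ => f (1/2)) (closure (Ioo (0:ℝ) 1)) := by
        refine EqOn.of_subset_closure (s := Ioo 0 1) (t := closure (Ioo (0:ℝ) 1)) ?_ ?_ continuousOn_const subset_closure subset_rfl
        · intro t ht; exact const t ht _ h2
        · rwa [closure_Ioo (by norm_num)]
      rw [closure_Ioo (by norm_num)] at this
      exact this
    have e := (all 1 i1).trans (all 0 i0).symm
    simp only [f] at e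
    linarith
  · have e1 := hφ _ (memd 1 i1)
    have e2 := hφ _ (memd 0 i0)
    rw [hU1 _ (memd 1 i1)] at e1
    rw [hU1 _ (memd 0 i0)] at e2
    rw [e1, e2, hD]
    simp only [Complex.ofReal_one, one_mul]
    rw [← Complex.exp_add]; congr 1; push_cast; ring

def sqm (ε : ℝ) : Set (ℝ × ℝ) := {p : ℝ × ℝ | 1 - ε ≤ p.1 ∧ p.1 ≤ 1 ∧ 0 ≤ p.2 ∧ p.2 ≤ ε ∧ p ≠ (1, 0)}

lemma convex_sqm (ε : ℝ) : Convex ℝ (sqm ε) := by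
  unfold sqm
  have : {p : ℝ × ℝ | 1 - ε ≤ p.1 ∧ p.1 ≤ 1 ∧ 0 ≤ p.2 ∧ p.2 ≤ ε ∧ p ≠ (1, 0)} =
    {p : ℝ × ℝ | 1 - ε ≤ p.1 ∧ p.1 ≤ 1 ∧ 0 ≤ p.2 ∧ p.2 ≤ ε ∧ 0 < (1 - p.1) + p.2} := by
    ext ⟨x, y⟩
    simp only [mem_ofPred_eq, ne_eq, Prod.mk.injEq]
    constructor
    · rintro ⟨h1, h2, h3, h4, h5⟩
      refine ⟨h1, h2, h3, h4, ?_⟩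
      by_contra h
      exact h5 ⟨by linarith, by linarith⟩
    · rintro ⟨h1, h2, h3, h4, h5⟩
      refine ⟨h1, h2, h3, h4, ?_⟩
      rintro ⟨rfl, rfl⟩
      simp at h5
  rw [this]
  intro x hx y hy a b ha hb hab
  obtain ⟨h1, h2, h3, h4, h5⟩ := hx
  obtain ⟨k1, k2, k3, k4, k5⟩ := hy
  refine ⟨?_, ?_, ?_, ?_, ?_⟩ <;> simp only [Prod.fst_add, Prod.snd_add, Prod.smul_fst, Prod.smul_snd, smul_eq_mul]
  · nlinarith
  · nlinarith
  · positivity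
  · nlinarith
  · have : 1 - (a * x.1 + b * y.1) + (a * x.2 + b * y.2) = a * (1 - x.1 + x.2) + b * (1 - y.1 + y.2) := by
      linear_combination -hab
    rw [this]
    rcases ha.eq_or_lt with rfl | ha
    · have : b = 1 := by linarith
      subst this; simpa using k5
    · have := mul_pos ha h5
      have := mul_nonneg hb k5.le
      linarith


lemma exists_corner {f : ℝ → ℂ} {x0 : ℝ} (hx0 : x0 ∈ Icc (0:ℝ) 1) (hf : ContinuousOn f (Icc 0 1))
    (m : ℂ) (h : 0 < (f x0 * m).re) :
    ∃ ε > 0, ∀ t ∈ Icc (0:ℝ) 1, |t - x0| ≤ ε → 0 < (f t * m).re := by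
  have h1 : ContinuousOn (fun t => (f t * m).re) (Icc 0 1) :=
    Complex.continuous_re.comp_continuousOn (hf.mul continuousOn_const)
  have h2 := (h1 x0 hx0).eventually (lt_mem_nhds h)
  rw [Metric.nhdsWithin_basis_ball.eventually_iff] at h2
  obtain ⟨δ, hδ, h3⟩ := h2
  refine ⟨δ / 2, by positivity, fun t ht htx => h3 ⟨?_, ht⟩⟩
  rw [Metric.mem_ball, Real.dist_eq]; linarith

lemma lift_arg_re {z : ℂ} : z = ‖z‖ * Complex.exp ((arg z : ℝ) * I) :=
  (Complex.norm_mul_exp_arg_mul_I z).symm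

lemma lemmaB {γ₁ γ₂ f₁ f₂ : ℝ → ℂ} {P : ℂ} (hγ₁ : ContinuousOn γ₁ (Icc 0 1))
    (hγ₂ : ContinuousOn γ₂ (Icc 0 1)) (hf₁ : ContinuousOn f₁ (Icc 0 1))
    (hf₂ : ContinuousOn f₂ (Icc 0 1)) (h1 : γ₁ 1 = P) (h2 : γ₂ 0 = P)
    (n1 : ∀ t ∈ Icc (0:ℝ) 1, f₁ t ≠ 0) (n2 : ∀ t ∈ Icc (0:ℝ) 1, f₂ t ≠ 0)
    (g1 : ∀ t ∈ Icc (0:ℝ) 1, t < 1 → P - γ₁ t = ‖P - γ₁ t‖ * f₁ t)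
    (g2 : ∀ t ∈ Icc (0:ℝ) 1, 0 < t → γ₂ t - P = ‖γ₂ t - P‖ * f₂ t)
    (hne : ∀ s ∈ Icc (0:ℝ) 1, ∀ t ∈ Icc (0:ℝ) 1, (s, t) ≠ ((1:ℝ), (0:ℝ)) → γ₁ s ≠ γ₂ t)
    {m : ℂ} (hm0 : m ≠ 0) (hm1 : 0 < (f₁ 1 * m).re) (hm2 : 0 < (f₂ 0 * m).re)
    {a b c₁ c₂ : ℝ} (ha : VarArg f₂ a) (hb : VarArg f₁ b)
    (hc₁ : VarArg (fun t => γ₁ t - γ₂ 1) c₁) (hc₂ : VarArg (fun t => γ₂ t - γ₁ 0) c₂) :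
    c₁ + c₂ - a - b = arg (f₂ 0 * m) - arg (f₁ 1 * m) := by
  have i0 : (0:ℝ) ∈ Icc (0:ℝ) 1 := by simp
  have i1 : (1:ℝ) ∈ Icc (0:ℝ) 1 := by simp
  obtain ⟨ε₁, hε₁, k1⟩ := exists_corner i1 hf₁ m hm1
  obtain ⟨ε₂, hε₂, k2⟩ := exists_corner i0 hf₂ m hm2
  obtain ⟨ε, hε, hε1, e1, e2⟩ : ∃ ε : ℝ, 0 < ε ∧ ε ≤ 1 ∧ ε ≤ ε₁ ∧ ε ≤ ε₂ :=
    ⟨min 1 (min ε₁ ε₂), by positivity, min_le_left _ _,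
      (min_le_right _ _).trans (min_le_left _ _), (min_le_right _ _).trans (min_le_right _ _)⟩
  let S : ℝ × ℝ → ℂ := fun p => γ₂ p.2 - γ₁ p.1
  have sub : ∀ p ∈ sqm 1, p.1 ∈ Icc (0:ℝ) 1 ∧ p.2 ∈ Icc (0:ℝ) 1 := fun p hp => by
    obtain ⟨q1, q2, q3, q4, q5⟩ := hp
    exact ⟨⟨by linarith, q2⟩, q3, q4⟩
  have Sc : ContinuousOn S (sqm 1) :=
    (hγ₂.comp continuousOn_snd fun p hp => (sub p hp).2).sub
      (hγ₁.comp continuousOn_fst fun p hp => (sub p hp).1)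
  have S0 : ∀ p ∈ sqm 1, S p ≠ 0 := fun p hp =>
    sub_ne_zero.2 (hne _ (sub p hp).1 _ (sub p hp).2 hp.2.2.2.2).symm
  obtain ⟨φ, φc, hφ⟩ := lift_arg (convex_sqm 1) Sc S0
  obtain ⟨α, αc, hα, ha⟩ := ha
  obtain ⟨β, βc, hβ, hb⟩ := hb
  obtain ⟨χ₁, χ₁c, hχ₁, hc₁⟩ := hc₁
  obtain ⟨χ₂, χ₂c, hχ₂, hc₂⟩ := hc₂
  have mem : ∀ s ∈ Icc (0:ℝ) 1, ∀ t ∈ Icc (0:ℝ) 1, (s < 1 ∨ 0 < t) → (s, t) ∈ sqm 1 := by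
    intro s hs t ht h
    refine ⟨by simpa using hs.1, hs.2, ht.1, ht.2, ?_⟩
    intro h'
    simp only [Prod.mk.injEq] at h'
    rcases h with h | h <;> linarith
  -- side t ↦ (0,t)
  have E2 := lift_diff_const isPreconnected_Icc (φ := fun t => φ (0, t)) (ψ := χ₂)
    (f := fun t => S (0, t))
    (φc.comp (by fun_prop) (fun t ht => mem 0 i0 t ht (Or.inl one_pos))) χ₂c
    (fun t ht => hφ _ (mem 0 i0 t ht (Or.inl one_pos))) hχ₂
    (fun t ht => S0 _ (mem 0 i0 t ht (Or.inl one_pos))) one_ne_zero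
    (fun t ht => ⟨1, one_pos, by simp [S]⟩) 1 i1 0 i0
  -- side s ↦ (s,1)
  have E1 := lift_diff_const isPreconnected_Icc (φ := fun t => φ (t, 1)) (ψ := χ₁)
    (f := fun t => S (t, 1))
    (φc.comp (by fun_prop) (fun t ht => mem t ht 1 i1 (Or.inr one_pos))) χ₁c
    (fun t ht => hφ _ (mem t ht 1 i1 (Or.inr one_pos))) hχ₁
    (fun t ht => S0 _ (mem t ht 1 i1 (Or.inr one_pos))) (c := -1) (by simp)
    (fun t ht => ⟨1, one_pos, by simp [S]⟩) 1 i1 0 i0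
  have sub1 : Ioc (0:ℝ) 1 ⊆ Icc 0 1 := Ioc_subset_Icc_self
  have sub2 : Ico (0:ℝ) 1 ⊆ Icc 0 1 := Ico_subset_Icc_self
  have pos2 : ∀ t ∈ Ioc (0:ℝ) 1, 0 < ‖γ₂ t - P‖ := fun t ht => by
    have := S0 _ (mem 1 i1 t (sub1 ht) (Or.inr ht.1))
    simp only [S, h1] at this
    exact norm_pos_iff.2 this
  have pos1 : ∀ t ∈ Ico (0:ℝ) 1, 0 < ‖P - γ₁ t‖ := fun t ht => by
    have := S0 _ (mem t (sub2 ht) 0 i0 (Or.inl ht.2))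
    simp only [S, h2] at this
    exact norm_pos_iff.2 this
  -- side t ↦ (1,t), t > 0
  have A := lift_diff_const isPreconnected_Ioc (φ := α) (ψ := fun t => φ (1, t))
    (f := f₂) (g := fun t => S (1, t)) (αc.mono sub1)
    (φc.comp (by fun_prop) (fun t ht => mem 1 i1 t (sub1 ht) (Or.inr ht.1)))
    (fun t ht => hα t (sub1 ht)) (fun t ht => hφ _ (mem 1 i1 t (sub1 ht) (Or.inr ht.1)))
    (fun t ht => n2 t (sub1 ht)) (c := 1) one_ne_zero
    (fun t ht => ⟨_, pos2 t ht, by simp only [S, h1, mul_one]; exact g2 t (sub1 ht) ht.1⟩)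
    1 ⟨one_pos, le_rfl⟩ ε ⟨hε, hε1⟩
  have B := lift_diff_const isPreconnected_Ico (φ := β) (ψ := fun t => φ (t, 0))
    (f := f₁) (g := fun t => S (t, 0)) (βc.mono sub2)
    (φc.comp (by fun_prop) (fun t ht => mem t (sub2 ht) 0 i0 (Or.inl ht.2)))
    (fun t ht => hβ t (sub2 ht)) (fun t ht => hφ _ (mem t (sub2 ht) 0 i0 (Or.inl ht.2)))
    (fun t ht => n1 t (sub2 ht)) (c := 1) one_ne_zero
    (fun t ht => ⟨_, pos1 t ht, by simp only [S, h2, mul_one]; exact g1 t (sub2 ht) ht.2⟩)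
    0 ⟨le_rfl, one_pos⟩ (1 - ε) ⟨by linarith, by linarith⟩
  -- corner
  have sube : sqm ε ⊆ sqm 1 := fun p hp => by
    obtain ⟨q1, q2, q3, q4, q5⟩ := hp
    exact ⟨by linarith, q2, q3, by linarith, q5⟩
  have re1 : ∀ t, 1 - ε ≤ t → t ≤ 1 → 0 < (f₁ t * m).re := fun t h h' =>
    k1 t ⟨by linarith, h'⟩ (by rw [abs_le]; constructor <;> linarith)
  have re2 : ∀ t, 0 ≤ t → t ≤ ε → 0 < (f₂ t * m).re := fun t h h' =>
    k2 t ⟨h, by linarith⟩ (by rw [abs_le]; constructor <;> linarith)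
  have reS : ∀ p ∈ sqm ε, 0 < (S p * m).re := by
    intro p hp
    have hp1 := sub p (sube hp)
    obtain ⟨q1, q2, q3, q4, q5⟩ := hp
    have r1 : P - γ₁ p.1 = ‖P - γ₁ p.1‖ * f₁ p.1 := by
      rcases q2.lt_or_eq with h | h
      · exact g1 _ hp1.1 h
      · rw [h, h1]; simp
    have r2 : γ₂ p.2 - P = ‖γ₂ p.2 - P‖ * f₂ p.2 := by
      rcases q3.lt_or_eq with h | h
      · exact g2 _ hp1.2 h
      · rw [← h, h2]; simp
    have : S p * m = (‖γ₂ p.2 - P‖ : ℂ) * (f₂ p.2 * m) + (‖P - γ₁ p.1‖ : ℂ) * (f₁ p.1 * m) := by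
      rw [← mul_assoc, ← mul_assoc, ← r1, ← r2]; simp only [S]; ring
    rw [this, Complex.add_re, Complex.re_ofReal_mul, Complex.re_ofReal_mul]
    have z1 := re1 p.1 q1 q2
    have z2 := re2 p.2 q3 q4
    rcases q2.lt_or_eq with h | h
    · have := pos1 p.1 ⟨hp1.1.1, h⟩
      positivity
    · rcases q3.lt_or_eq with h' | h'
      · have := pos2 p.2 ⟨h', hp1.2.2⟩
        positivity
      · exact absurd (Prod.ext h h'.symm) q5
  have argc : ∀ {X : Type} [TopologicalSpace X] {s : Set X} {f : X → ℂ}, ContinuousOn f s →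
      (∀ x ∈ s, 0 < (f x * m).re) → ContinuousOn (fun x => arg (f x * m)) s := by
    intro X _ s f hf h x hx
    exact ContinuousAt.comp_continuousWithinAt (g := arg)
      (Complex.continuousAt_arg (Or.inl (h x hx))) ((hf x hx).mul continuousWithinAt_const)
  have C := lift_diff_const (convex_sqm ε).isPreconnected (φ := φ) (ψ := fun p => arg (S p * m))
    (f := S) (g := fun p => S p * m) (φc.mono sube) (argc (Sc.mono sube) reS)
    (fun p hp => hφ p (sube hp)) (fun p hp => lift_arg_re) (fun p hp => S0 p (sube hp)) hm0
    (fun p hp => ⟨1, one_pos, by push_cast; ring⟩) (1, ε)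
    ⟨by simpa using hε.le, le_rfl, hε.le, le_rfl, by simp [hε.ne']⟩ (1 - ε, 0)
    ⟨le_rfl, by linarith, le_rfl, hε.le, by simp [hε.ne']⟩
  have A' := lift_diff_const (isPreconnected_Icc (a := 0) (b := ε)) (φ := α) (ψ := fun t => arg (f₂ t * m))
    (f := f₂) (g := fun t => f₂ t * m) (αc.mono (Icc_subset_Icc_right hε1))
    (argc (hf₂.mono (Icc_subset_Icc_right hε1)) (fun t ht => re2 t ht.1 ht.2))
    (fun t ht => hα t ⟨ht.1, ht.2.trans hε1⟩) (fun t ht => lift_arg_re)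
    (fun t ht => n2 t ⟨ht.1, ht.2.trans hε1⟩) hm0 (fun t ht => ⟨1, one_pos, by push_cast; ring⟩)
    0 ⟨le_rfl, hε.le⟩ ε ⟨hε.le, le_rfl⟩
  have hs1 : Icc (1 - ε) 1 ⊆ Icc (0:ℝ) 1 := Icc_subset_Icc_left (by linarith)
  have B' := lift_diff_const (isPreconnected_Icc (a := 1 - ε) (b := 1)) (φ := β) (ψ := fun t => arg (f₁ t * m))
    (f := f₁) (g := fun t => f₁ t * m) (βc.mono hs1)
    (argc (hf₁.mono hs1) (fun t ht => re1 t ht.1 ht.2))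
    (fun t ht => hβ t (hs1 ht)) (fun t ht => lift_arg_re)
    (fun t ht => n1 t (hs1 ht)) hm0 (fun t ht => ⟨1, one_pos, by push_cast; ring⟩)
    1 ⟨by linarith, le_rfl⟩ (1 - ε) ⟨le_rfl, by linarith⟩
  have Q1 : arg (S (1, ε) * m) = arg (f₂ ε * m) := by
    have := g2 ε ⟨hε.le, hε1⟩ hε
    simp only [S, h1]
    rw [this, mul_assoc, Complex.arg_real_mul _ (pos2 ε ⟨hε, hε1⟩)]
  have Q2 : arg (S (1 - ε, 0) * m) = arg (f₁ (1 - ε) * m) := by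
    have := g1 (1 - ε) ⟨by linarith, by linarith⟩ (by linarith)
    simp only [S, h2]
    rw [this, mul_assoc, Complex.arg_real_mul _ (pos1 (1 - ε) ⟨by linarith, by linarith⟩)]
  rw [Q1, Q2] at C
  linarith


lemma corner {e₁ e₂ : ℂ} (h1 : ‖e₁‖ = 1) (h2 : ‖e₂‖ = 1) (h : e₁ + e₂ ≠ 0) (h3 : e₂ ^ 3 = - e₁ ^ 3) :
    ∃ m : ℂ, m ≠ 0 ∧ 0 < (e₁ * m).re ∧ 0 < (e₂ * m).re ∧
      (arg (e₂ * m) - arg (e₁ * m) = Real.pi / 3 ∨ arg (e₂ * m) - arg (e₁ * m) = - (Real.pi / 3)) ∧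
      Complex.exp ((arg (e₂ * m) - arg (e₁ * m) : ℝ) * I) * e₁ = e₂ := by
  have hm : (starRingEnd ℂ) (e₁ + e₂) ≠ 0 := (map_ne_zero _).2 h
  set m := (starRingEnd ℂ) (e₁ + e₂) with hmdef
  have s1 : e₁.re ^ 2 + e₁.im ^ 2 = 1 := by
    have := Complex.sq_norm e₁; rw [h1, Complex.normSq_apply] at this; linarith
  have s2 : e₂.re ^ 2 + e₂.im ^ 2 = 1 := by
    have := Complex.sq_norm e₂; rw [h2, Complex.normSq_apply] at this; linarith
  have s3 : 0 < (e₁.re + e₂.re) ^ 2 + (e₁.im + e₂.im) ^ 2 := by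
    have := Complex.normSq_pos.2 h
    rw [Complex.normSq_apply] at this; simp at this; linarith
  have r1 : 0 < (e₁ * m).re := by
    simp [hmdef, Complex.mul_re]; nlinarith
  have r2 : 0 < (e₂ * m).re := by
    simp [hmdef, Complex.mul_re]; nlinarith
  refine ⟨m, hm, r1, r2, ?_⟩
  set δ := arg (e₂ * m) - arg (e₁ * m) with hδ
  have a1 := abs_lt.1 (Complex.abs_arg_lt_pi_div_two_iff.2 (Or.inl r1))
  have a2 := abs_lt.1 (Complex.abs_arg_lt_pi_div_two_iff.2 (Or.inl r2))
  have e10 : e₁ ≠ 0 := by intro h; simp [h] at h1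
  have hexp : Complex.exp (δ * I) * e₁ = e₂ := by
    rcases exp_of_lift (z := e₁ * m) (w := e₂ * m) lift_arg_re lift_arg_re (mul_ne_zero e10 hm)
      (r := e₂ / e₁) (by field_simp) with h | h
    · rw [hδ, h, norm_div, h1, h2]; simp [e10]
    · rw [div_eq_zero_iff] at h
      rcases h with h | h
      · simp [h] at h2
      · exact absurd h e10
  refine ⟨?_, hexp⟩
  have c3 : Complex.exp ((3 * δ : ℝ) * I) = Complex.exp (Real.pi * I) := by
    rw [Complex.exp_pi_mul_I]
    have : Complex.exp ((3 * δ : ℝ) * I) = Complex.exp (δ * I) ^ 3 := by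
      rw [← Complex.exp_nat_mul]; congr 1; push_cast; ring
    rw [this]
    apply mul_right_cancel₀ (pow_ne_zero 3 e10)
    rw [← mul_pow, hexp, h3]; ring
  rw [Complex.exp_eq_exp_iff_exists_int] at c3
  obtain ⟨n, hn⟩ := c3
  have h2 : ((3 * δ : ℝ) : ℂ) = ((Real.pi + n * (2 * Real.pi) : ℝ) : ℂ) := by
    apply mul_right_cancel₀ I_ne_zero
    rw [hn]; push_cast; ring
  have h4 : 3 * δ = Real.pi + n * (2 * Real.pi) := by exact_mod_cast h2
  have hpi := Real.pi_pos
  have u1 : (n : ℝ) < 1 := by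
    by_contra hh; push Not at hh
    nlinarith
  have u2 : (-2 : ℝ) < n := by
    by_contra hh; push Not at hh
    nlinarith
  have u1' : n < 1 := by exact_mod_cast u1
  have u2' : -2 < n := by exact_mod_cast u2
  have : n = 0 ∨ n = -1 := by omega
  rcases this with rfl | rfl
  · left; push_cast at h4; linarith
  · right; push_cast at h4; linarith

structure ArcData (c P Q R : ℂ) (γ : ℝ → ℂ) (U : ℝ × ℝ → ℂ) : Prop where
  hγ : ContinuousOn γ (Icc 0 1)
  h0 : γ 0 = P
  h1 : γ 1 = Q
  hP : ∀ t ∈ Ioo (0:ℝ) 1, γ t ≠ P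
  hQ : ∀ t ∈ Ioo (0:ℝ) 1, γ t ≠ Q
  hR : ∀ t ∈ Icc (0:ℝ) 1, γ t ≠ R
  hU : ContinuousOn U tri
  hU1 : ∀ p ∈ tri, ‖U p‖ = 1
  hUs : ∀ s t, 0 ≤ s → s < t → t ≤ 1 → γ t - γ s = ‖γ t - γ s‖ * U (s, t)
  hUd : ∀ t ∈ Ioo (0:ℝ) 1, ∃ r : ℝ, 0 < r ∧
      U (t, t) ^ 2 * (c * (γ t - P) * (γ t - Q) * (γ t - R)) = r

lemma real_nonneg_limit {f : ℝ → ℂ} {x : ℝ} (hx : x ∈ Icc (0:ℝ) 1) (hf : ContinuousOn f (Icc 0 1))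
    (h : ∀ t ∈ Ioo (0:ℝ) 1, ∃ r : ℝ, 0 < r ∧ f t = r) : ∃ r : ℝ, 0 ≤ r ∧ f x = r := by
  have hcl : IsClosed {z : ℂ | 0 ≤ z.re ∧ z.im = 0} :=
    (isClosed_le continuous_const Complex.continuous_re).inter
      (isClosed_eq Complex.continuous_im continuous_const)
  have hx' : x ∈ closure (Ioo (0:ℝ) 1) := by rwa [closure_Ioo (by norm_num)]
  have h2 : ContinuousOn f (closure (Ioo (0:ℝ) 1)) := by rwa [closure_Ioo (by norm_num)]
  have := h2.image_closure ⟨x, hx', rfl⟩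
  have h3 : closure (f '' Ioo (0:ℝ) 1) ⊆ {z : ℂ | 0 ≤ z.re ∧ z.im = 0} := by
    apply closure_minimal _ hcl
    rintro _ ⟨t, ht, rfl⟩
    obtain ⟨r, hr, e⟩ := h t ht
    simp only [e, mem_ofPred_eq]
    exact ⟨by simpa using hr.le, by simp⟩
  obtain ⟨u, v⟩ := h3 this
  exact ⟨(f x).re, u, Complex.ext (by simp) (by simp [v])⟩

namespace ArcData
variable {c P Q R : ℂ} {γ : ℝ → ℂ} {U : ℝ × ℝ → ℂ}

lemma cube0 (h : ArcData c P Q R γ U) :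
    U (0, 0) ^ 3 * (c * (P - Q) * (P - R)) = ‖c * (P - Q) * (P - R)‖ := by
  have mem0 : ∀ t ∈ Icc (0:ℝ) 1, ((0:ℝ), t) ∈ tri := fun t ht => ⟨le_rfl, ht.1, ht.2⟩
  have memd : ∀ t ∈ Icc (0:ℝ) 1, (t, t) ∈ tri := fun t ht => ⟨ht.1, le_rfl, ht.2⟩
  have i0 : (0:ℝ) ∈ Icc (0:ℝ) 1 := by simp
  have cc : ContinuousOn (fun t => U (t, t) ^ 2 * U (0, t) * (c * (γ t - Q) * (γ t - R))) (Icc 0 1) := by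
    have c1 : ContinuousOn (fun t : ℝ => U (0, t)) (Icc 0 1) := h.hU.comp (by fun_prop) mem0
    have c2 : ContinuousOn (fun t : ℝ => U (t, t)) (Icc 0 1) := h.hU.comp (by fun_prop) memd
    exact ((c2.pow 2).mul c1).mul ((continuousOn_const.mul (h.hγ.sub continuousOn_const)).mul (h.hγ.sub continuousOn_const))
  obtain ⟨r, hr, e⟩ := real_nonneg_limit i0 cc (fun t ht => by
    obtain ⟨r, hr, e⟩ := h.hUd t ht
    have f1 := h.hUs 0 t le_rfl ht.1 ht.2.le
    rw [h.h0] at f1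
    have n1 : 0 < ‖γ t - P‖ := norm_pos_iff.2 (sub_ne_zero.2 (h.hP t ht))
    have n1' : (‖γ t - P‖ : ℂ) ≠ 0 := by exact_mod_cast n1.ne'
    refine ⟨r / ‖γ t - P‖, by positivity, ?_⟩
    push_cast
    rw [eq_div_iff n1', ← e]
    linear_combination (-(U (t, t) ^ 2 * (c * (γ t - Q) * (γ t - R)))) * f1)
  have e' : U (0, 0) ^ 3 * (c * (P - Q) * (P - R)) = r := by
    rw [← e, h.h0]; ring
  have := congrArg norm e'
  rw [norm_mul, norm_pow, h.hU1 _ (mem0 0 i0), Complex.norm_real, Real.norm_eq_abs, abs_of_nonneg hr] at this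
  rw [e', ← this]; simp

lemma cube1 (h : ArcData c P Q R γ U) :
    U (1, 1) ^ 3 * (c * (Q - P) * (Q - R)) = - ‖c * (Q - P) * (Q - R)‖ := by
  have mem1 : ∀ t ∈ Icc (0:ℝ) 1, (t, (1:ℝ)) ∈ tri := fun t ht => ⟨ht.1, ht.2, le_rfl⟩
  have memd : ∀ t ∈ Icc (0:ℝ) 1, (t, t) ∈ tri := fun t ht => ⟨ht.1, le_rfl, ht.2⟩
  have i1 : (1:ℝ) ∈ Icc (0:ℝ) 1 := by simp
  have cc : ContinuousOn (fun t => - U (t, t) ^ 2 * U (t, 1) * (c * (γ t - P) * (γ t - R))) (Icc 0 1) := by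
    have c1 : ContinuousOn (fun t : ℝ => U (t, 1)) (Icc 0 1) := h.hU.comp (by fun_prop) mem1
    have c2 : ContinuousOn (fun t : ℝ => U (t, t)) (Icc 0 1) := h.hU.comp (by fun_prop) memd
    exact ((c2.pow 2).neg.mul c1).mul ((continuousOn_const.mul (h.hγ.sub continuousOn_const)).mul (h.hγ.sub continuousOn_const))
  obtain ⟨r, hr, e⟩ := real_nonneg_limit i1 cc (fun t ht => by
    obtain ⟨r, hr, e⟩ := h.hUd t ht
    have f1 := h.hUs t 1 ht.1.le ht.2 le_rfl
    rw [h.h1] at f1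
    have n1 : 0 < ‖Q - γ t‖ := norm_pos_iff.2 (sub_ne_zero.2 (h.hQ t ht).symm)
    have n1' : (‖Q - γ t‖ : ℂ) ≠ 0 := by exact_mod_cast n1.ne'
    refine ⟨r / ‖Q - γ t‖, by positivity, ?_⟩
    push_cast
    rw [eq_div_iff n1', ← e]
    linear_combination ((U (t, t) ^ 2 * (c * (γ t - P) * (γ t - R)))) * f1)
  have e' : U (1, 1) ^ 3 * (c * (Q - P) * (Q - R)) = - r := by
    rw [← e, h.h1]; ring
  have := congrArg norm e'
  rw [norm_mul, norm_pow, h.hU1 _ (mem1 1 i1), norm_neg, Complex.norm_real, Real.norm_eq_abs, abs_of_nonneg hr] at this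
  rw [e', ← this]; simp

lemma exists_vars (h : ArcData c P Q R γ U) (hc : c ≠ 0) :
    ∃ a b d : ℝ, VarArg (fun t => U (0, t)) a ∧ VarArg (fun t => U (t, 1)) b ∧
      VarArg (fun t => γ t - R) d ∧ 3 * (a + b) = - d ∧
      Complex.exp ((a + b : ℝ) * I) * U (0, 0) = U (1, 1) := by
  have hU0 : ∀ p ∈ tri, U p ≠ 0 := fun p hp h' => by
    have := h.hU1 p hp; rw [h'] at this; simp at this
  have mem0 : ∀ t ∈ Icc (0:ℝ) 1, ((0:ℝ), t) ∈ tri := fun t ht => ⟨le_rfl, ht.1, ht.2⟩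
  have mem1 : ∀ t ∈ Icc (0:ℝ) 1, (t, (1:ℝ)) ∈ tri := fun t ht => ⟨ht.1, ht.2, le_rfl⟩
  obtain ⟨a, ha⟩ := VarArg.exists (f := fun t => U (0, t)) (h.hU.comp (by fun_prop) mem0)
    (fun t ht => hU0 _ (mem0 t ht))
  obtain ⟨b, hb⟩ := VarArg.exists (f := fun t => U (t, 1)) (h.hU.comp (by fun_prop) mem1)
    (fun t ht => hU0 _ (mem1 t ht))
  obtain ⟨d, hd⟩ := VarArg.exists (f := fun t => γ t - R) (h.hγ.sub continuousOn_const)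
    (fun t ht => sub_ne_zero.2 (h.hR t ht))
  exact ⟨a, b, d, ha, hb, hd, lemmaA hc h.h0 h.h1 h.hP h.hQ h.hR h.hU h.hU1 h.hUs h.hUd ha hb hd⟩

end ArcData

lemma pairCorner {c P Q R : ℂ} {γ₁ γ₂ : ℝ → ℂ} {U₁ U₂ : ℝ × ℝ → ℂ} (hc : c ≠ 0)
    (hPQ : P ≠ Q) (hQR : Q ≠ R)
    (H1 : ArcData c P Q R γ₁ U₁) (H2 : ArcData c Q R P γ₂ U₂)
    (hne : ∀ s ∈ Icc (0:ℝ) 1, ∀ t ∈ Icc (0:ℝ) 1, (s, t) ≠ ((1:ℝ), (0:ℝ)) → γ₁ s ≠ γ₂ t)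
    (hop : U₁ (1, 1) + U₂ (0, 0) ≠ 0)
    {a b c₁ c₂ : ℝ} (ha : VarArg (fun t => U₂ (0, t)) a) (hb : VarArg (fun t => U₁ (t, 1)) b)
    (hc₁ : VarArg (fun t => γ₁ t - R) c₁) (hc₂ : VarArg (fun t => γ₂ t - P) c₂) :
    (c₁ + c₂ - a - b = Real.pi / 3 ∨ c₁ + c₂ - a - b = - (Real.pi / 3)) ∧
      Complex.exp ((c₁ + c₂ - a - b : ℝ) * I) * U₁ (1, 1) = U₂ (0, 0) := by
  have mem0 : ∀ t ∈ Icc (0:ℝ) 1, ((0:ℝ), t) ∈ tri := fun t ht => ⟨le_rfl, ht.1, ht.2⟩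
  have mem1 : ∀ t ∈ Icc (0:ℝ) 1, (t, (1:ℝ)) ∈ tri := fun t ht => ⟨ht.1, ht.2, le_rfl⟩
  have i0 : (0:ℝ) ∈ Icc (0:ℝ) 1 := by simp
  have i1 : (1:ℝ) ∈ Icc (0:ℝ) 1 := by simp
  have k1 := H1.cube1
  have k2 := H2.cube0
  have hk : c * (Q - P) * (Q - R) ≠ 0 :=
    mul_ne_zero (mul_ne_zero hc (sub_ne_zero.2 hPQ.symm)) (sub_ne_zero.2 hQR)
  have k3 : U₂ (0, 0) ^ 3 = - U₁ (1, 1) ^ 3 := by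
    apply mul_right_cancel₀ hk
    have : c * (Q - R) * (Q - P) = c * (Q - P) * (Q - R) := by ring
    rw [this] at k2
    rw [k2, neg_mul, k1, neg_neg]
  obtain ⟨m, hm0, r1, r2, hδ, he⟩ := corner (H1.hU1 _ (mem1 1 i1)) (H2.hU1 _ (mem0 0 i0)) hop k3
  have n1 : ∀ t ∈ Icc (0:ℝ) 1, U₁ (t, 1) ≠ 0 := fun t ht h => by
    have := H1.hU1 _ (mem1 t ht); rw [h] at this; simp at this
  have n2 : ∀ t ∈ Icc (0:ℝ) 1, U₂ (0, t) ≠ 0 := fun t ht h => by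
    have := H2.hU1 _ (mem0 t ht); rw [h] at this; simp at this
  have := lemmaB (f₁ := fun t => U₁ (t, 1)) (f₂ := fun t => U₂ (0, t)) H1.hγ H2.hγ
    (H1.hU.comp (by fun_prop) mem1) (H2.hU.comp (by fun_prop) mem0) H1.h1 H2.h0 n1 n2
    (fun t ht h => by rw [← H1.h1]; exact H1.hUs t 1 ht.1 h le_rfl)
    (fun t ht h => by rw [← H2.h0]; exact H2.hUs 0 t le_rfl h ht.2)
    hne hm0 r1 r2 ha hb (by rwa [H2.h1]) (by rwa [H1.h0])
  rw [this]
  exact ⟨hδ, he⟩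

lemma topMain {c P Q R : ℂ} {γ₀ γ₁ γ₂ : ℝ → ℂ} {U₀ U₁ U₂ : ℝ × ℝ → ℂ} (hc : c ≠ 0)
    (hPQ : P ≠ Q) (hQR : Q ≠ R) (hRP : R ≠ P)
    (H0 : ArcData c P Q R γ₀ U₀) (H1 : ArcData c Q R P γ₁ U₁) (H2 : ArcData c R P Q γ₂ U₂)
    (n0 : ∀ s ∈ Icc (0:ℝ) 1, ∀ t ∈ Icc (0:ℝ) 1, (s, t) ≠ ((1:ℝ), (0:ℝ)) → γ₀ s ≠ γ₁ t)
    (n1 : ∀ s ∈ Icc (0:ℝ) 1, ∀ t ∈ Icc (0:ℝ) 1, (s, t) ≠ ((1:ℝ), (0:ℝ)) → γ₁ s ≠ γ₂ t)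
    (n2 : ∀ s ∈ Icc (0:ℝ) 1, ∀ t ∈ Icc (0:ℝ) 1, (s, t) ≠ ((1:ℝ), (0:ℝ)) → γ₂ s ≠ γ₀ t)
    (o0 : U₀ (1, 1) + U₁ (0, 0) ≠ 0) (o1 : U₁ (1, 1) + U₂ (0, 0) ≠ 0)
    (o2 : U₂ (1, 1) + U₀ (0, 0) ≠ 0) : False := by
  obtain ⟨a0, b0, d0, ha0, hb0, hd0, e0, x0⟩ := H0.exists_vars hc
  obtain ⟨a1, b1, d1, ha1, hb1, hd1, e1, x1⟩ := H1.exists_vars hc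
  obtain ⟨a2, b2, d2, ha2, hb2, hd2, e2, x2⟩ := H2.exists_vars hc
  obtain ⟨p0, y0⟩ := pairCorner hc hPQ hQR H0 H1 n0 o0 ha1 hb0 hd0 hd1
  obtain ⟨p1, y1⟩ := pairCorner hc hQR hRP H1 H2 n1 o1 ha2 hb1 hd1 hd2
  obtain ⟨p2, y2⟩ := pairCorner hc hRP hPQ H2 H0 n2 o2 ha0 hb2 hd2 hd0
  have hu : U₀ (0, 0) ≠ 0 := fun h => by
    have := H0.hU1 (0, 0) ⟨le_rfl, le_rfl, zero_le_one⟩; rw [h] at this; simp at this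
  have tot : Complex.exp (((a0 + b0) + (a1 + b1) + (a2 + b2) + (d0 + d1 - a1 - b0)
      + (d1 + d2 - a2 - b1) + (d2 + d0 - a0 - b2) : ℝ) * I) = 1 := by
    apply mul_right_cancel₀ hu
    rw [one_mul]
    conv_rhs => rw [← y2, ← x2, ← y1, ← x1, ← y0, ← x0]
    simp only [← mul_assoc, ← Complex.exp_add]
    congr 2; push_cast; ring
  rw [Complex.exp_eq_one_iff] at tot
  obtain ⟨n, hn⟩ := tot
  have h2 : ((2 * (d0 + d1 + d2) : ℝ) : ℂ) = ((n * (2 * Real.pi) : ℝ) : ℂ) := by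
    apply mul_right_cancel₀ I_ne_zero
    have : (((a0 + b0) + (a1 + b1) + (a2 + b2) + (d0 + d1 - a1 - b0)
      + (d1 + d2 - a2 - b1) + (d2 + d0 - a0 - b2) : ℝ) : ℂ) = ((2 * (d0 + d1 + d2) : ℝ) : ℂ) := by
      congr 1; ring
    rw [this] at hn
    rw [hn]; push_cast; ring
  have h4 : 2 * (d0 + d1 + d2) = n * (2 * Real.pi) := by exact_mod_cast h2
  have hpi := Real.pi_pos
  -- sum of corner angles = (7/3) * n * pi
  have h5 : (d0 + d1 - a1 - b0) + (d1 + d2 - a2 - b1) + (d2 + d0 - a0 - b2) = 7 / 3 * (n * Real.pi) := by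
    linarith
  have u1 : (n : ℝ) < 1 := by
    by_contra hh; push Not at hh
    have : Real.pi ≤ n * Real.pi := by nlinarith
    rcases p0 with p0 | p0 <;> rcases p1 with p1 | p1 <;> rcases p2 with p2 | p2 <;> linarith
  have u2 : (-1 : ℝ) < n := by
    by_contra hh; push Not at hh
    have : n * Real.pi ≤ - Real.pi := by nlinarith
    rcases p0 with p0 | p0 <;> rcases p1 with p1 | p1 <;> rcases p2 with p2 | p2 <;> linarith
  have u1' : n < 1 := by exact_mod_cast u1
  have u2' : -1 < n := by exact_mod_cast u2
  have : n = 0 := by omega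
  subst this
  simp only [Int.cast_zero, zero_mul, mul_zero] at h5
  rcases p0 with p0 | p0 <;> rcases p1 with p1 | p1 <;> rcases p2 with p2 | p2 <;> linarith

def IsArc (q : ℂ → ℂ) (γ : ℝ → ℂ) : Prop :=
  ContinuousOn γ (Icc 0 1) ∧ ∀ t ∈ Ioo (0:ℝ) 1, ∃ d : ℂ, HasDerivAt γ d t ∧
    ∃ r : ℝ, 0 < r ∧ q (γ t) * d ^ 2 = r

lemma IsArc.ne {q : ℂ → ℂ} {γ : ℝ → ℂ} (h : IsArc q γ) : ∀ t ∈ Ioo (0:ℝ) 1, q (γ t) ≠ 0 := by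
  intro t ht h0
  obtain ⟨d, -, r, hr, e⟩ := h.2 t ht
  rw [h0, zero_mul] at e
  exact hr.ne (by exact_mod_cast e)

lemma exists_root {k : ℂ → ℂ} {A : ℂ} (hk : AnalyticAt ℂ k A) (h0 : k A ≠ 0) (n : ℕ) (hn : n ≠ 0) :
    ∃ s : ℂ → ℂ, AnalyticAt ℂ s A ∧ s A ≠ 0 ∧ ∀ z, s z ^ n = k z := by
  refine ⟨fun z => (k z / k A) ^ ((n : ℂ)⁻¹) * (k A) ^ ((n : ℂ)⁻¹), ?_, ?_, ?_⟩
  · refine AnalyticAt.mul (AnalyticAt.cpow (hk.div analyticAt_const h0) analyticAt_const ?_) analyticAt_const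
    simp [h0]
  · simp [h0]
  · intro z
    rw [mul_pow, Complex.cpow_nat_inv_pow _ hn, Complex.cpow_nat_inv_pow _ hn]
    field_simp

lemma exists_primitive {s : ℂ → ℂ} {A : ℂ} (hs : AnalyticAt ℂ s A) :
    ∃ F : ℂ → ℂ, F A = 0 ∧ ∃ r > 0, ∀ z ∈ Metric.ball A r, HasDerivAt F (s z) z := by
  obtain ⟨r, hr, h⟩ := Metric.eventually_nhds_iff_ball.1 hs.eventually_analyticAt
  have hd : DifferentiableOn ℂ s (Metric.ball A r) :=
    fun z hz => (h z hz).differentiableAt.differentiableWithinAt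
  obtain ⟨F, h1, h2⟩ := hd.isExactOn_ball.with_val_at A 0
  exact ⟨F, h1, r, hr, h2⟩

lemma analyticAt_of_ball {F s : ℂ → ℂ} {A : ℂ} {r : ℝ} (hr : 0 < r)
    (h : ∀ z ∈ Metric.ball A r, HasDerivAt F (s z) z) : AnalyticAt ℂ F A := by
  have hd : DifferentiableOn ℂ F (Metric.ball A r) :=
    fun z hz => (h z hz).differentiableAt.differentiableWithinAt
  exact hd.analyticAt (Metric.ball_mem_nhds A hr)

lemma real_deriv {h : ℝ → ℂ} {a b : ℝ} (hc : ContinuousOn h (Icc a b))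
    (hd : ∀ t ∈ Ioo a b, ∃ d : ℂ, HasDerivAt h d t ∧ ∃ r : ℝ, 0 < r ∧ d ^ 2 = r) :
    (∀ x ∈ Icc a b, ∀ y ∈ Icc a b, (h x).im = (h y).im) ∧
    (StrictMonoOn (fun t => (h t).re) (Icc a b) ∨ StrictAntiOn (fun t => (h t).re) (Icc a b)) := by
  choose! d hd1 r hr hd2 using hd
  have him : ∀ t ∈ Ioo a b, (d t).im = 0 ∧ (d t).re ≠ 0 := by
    intro t ht
    have e := hd2 t ht
    have e1 := congrArg Complex.re e
    have e2 := congrArg Complex.im e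
    simp [pow_two] at e1 e2
    have hr := hr t ht
    have : (d t).re * (d t).im = 0 := by linarith
    rcases mul_eq_zero.1 this with h | h
    · rw [h] at e1; nlinarith [sq_nonneg (d t).im]
    · refine ⟨h, fun h' => ?_⟩
      rw [h, h'] at e1; simp at e1; linarith
  have dre : ∀ t ∈ Ioo a b, HasDerivAt (fun t => (h t).re) (d t).re t := fun t ht =>
    (Complex.reCLM.hasFDerivAt.comp_hasDerivAt t (hd1 t ht))
  have dim : ∀ t ∈ Ioo a b, HasDerivAt (fun t => (h t).im) (d t).im t := fun t ht =>
    (Complex.imCLM.hasFDerivAt.comp_hasDerivAt t (hd1 t ht))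
  have cre : ContinuousOn (fun t => (h t).re) (Icc a b) := Complex.continuous_re.comp_continuousOn hc
  have cim : ContinuousOn (fun t => (h t).im) (Icc a b) := Complex.continuous_im.comp_continuousOn hc
  constructor
  · have m1 : MonotoneOn (fun t => (h t).im) (Icc a b) := by
      apply monotoneOn_of_deriv_nonneg (convex_Icc a b) cim
      · rw [interior_Icc]; exact fun t ht => (dim t ht).differentiableAt.differentiableWithinAt
      · rw [interior_Icc]; intro t ht; rw [(dim t ht).deriv, (him t ht).1]
    have m2 : AntitoneOn (fun t => (h t).im) (Icc a b) := by
      apply antitoneOn_of_deriv_nonpos (convex_Icc a b) cim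
      · rw [interior_Icc]; exact fun t ht => (dim t ht).differentiableAt.differentiableWithinAt
      · rw [interior_Icc]; intro t ht; rw [(dim t ht).deriv, (him t ht).1]
    intro x hx y hy
    rcases le_total x y with hxy | hxy
    · exact le_antisymm (m1 hx hy hxy) (m2 hx hy hxy)
    · exact le_antisymm (m2 hy hx hxy) (m1 hy hx hxy)
  · rcases hasDerivWithinAt_forall_lt_or_forall_gt_of_forall_ne (convex_Ioo a b)
      (fun t ht => (dre t ht).hasDerivWithinAt) (fun t ht => (him t ht).2) with hs | hs
    · right
      apply strictAntiOn_of_deriv_neg (convex_Icc a b) cre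
      rw [interior_Icc]; intro t ht; rw [(dre t ht).deriv]; exact hs t ht
    · left
      apply strictMonoOn_of_deriv_pos (convex_Icc a b) cre
      rw [interior_Icc]; intro t ht; rw [(dre t ht).deriv]; exact hs t ht

lemma reg {q : ℂ → ℂ} (hq : Differentiable ℂ q) {z0 : ℂ} (h0 : q z0 ≠ 0) :
    ∃ (G : ℂ → ℂ) (ω : ℂ), ω ^ 2 = q z0 ∧ HasStrictDerivAt G ω⁻¹ 0 ∧
      ∀ (γ : ℝ → ℂ) (t0 : ℝ), IsArc q γ → t0 ∈ Ioo (0:ℝ) 1 → γ t0 = z0 →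
        ∃ ε > 0, ∃ σ : ℝ → ℝ, Icc (t0 - ε) (t0 + ε) ⊆ Ioo 0 1 ∧
          ContinuousOn σ (Icc (t0 - ε) (t0 + ε)) ∧ σ t0 = 0 ∧
          (StrictMonoOn σ (Icc (t0 - ε) (t0 + ε)) ∨ StrictAntiOn σ (Icc (t0 - ε) (t0 + ε))) ∧
          (∀ t ∈ Icc (t0 - ε) (t0 + ε), γ t = G (σ t)) ∧ InjOn γ (Icc (t0 - ε) (t0 + ε)) := by
  obtain ⟨s, hs, hs0, hsq⟩ := exists_root (hq.analyticAt z0) h0 2 two_ne_zero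
  obtain ⟨F, hF0, r, hr, hF⟩ := exists_primitive hs
  have hFa : AnalyticAt ℂ F z0 := analyticAt_of_ball hr hF
  have hst : HasStrictDerivAt F (s z0) z0 := by
    have := hFa.hasStrictDerivAt
    rwa [(hF z0 (Metric.mem_ball_self hr)).deriv] at this
  refine ⟨hst.localInverse F (s z0) z0 hs0, s z0, hsq z0, ?_, ?_⟩
  · have := hst.to_localInverse hs0
    rwa [hF0] at this
  intro γ t0 hγ ht0 hz
  have hcont : ContinuousAt γ t0 := (hγ.2 t0 ht0).choose_spec.1.continuousAt
  have ev1 : ∀ᶠ z in nhds z0, z ∈ Metric.ball z0 r ∧ hst.localInverse F (s z0) z0 hs0 (F z) = z :=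
    Filter.Eventually.and (Metric.ball_mem_nhds z0 hr) (hst.eventually_left_inverse hs0)
  have hcont' : Filter.Tendsto γ (nhds t0) (nhds z0) := hz ▸ hcont.tendsto
  have ev2 := (hcont'.eventually ev1).and (Ioo_mem_nhds ht0.1 ht0.2)
  obtain ⟨ε, hε, h⟩ := Metric.nhds_basis_closedBall.eventually_iff.1 ev2
  rw [Real.closedBall_eq_Icc] at h
  have hsub : Icc (t0 - ε) (t0 + ε) ⊆ Ioo 0 1 := fun t ht => (h ht).2
  have mem0 : t0 ∈ Icc (t0 - ε) (t0 + ε) := ⟨by linarith, by linarith⟩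
  have hder : ∀ t ∈ Icc (t0 - ε) (t0 + ε), ∃ d : ℂ, HasDerivAt (fun t => F (γ t)) d t ∧
      ∃ r : ℝ, 0 < r ∧ d ^ 2 = r := by
    intro t ht
    obtain ⟨d, hd, r', hr', e⟩ := hγ.2 t (hsub ht)
    refine ⟨s (γ t) * d, ?_, r', hr', ?_⟩
    · have := (h ht).1.1
      exact (hF _ this).comp t hd
    · rw [mul_pow, hsq, e]
  obtain ⟨him, hmono⟩ := real_deriv (h := fun t => F (γ t))
    (fun t ht => (hder t ht).choose_spec.1.continuousAt.continuousWithinAt)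
    (fun t ht => hder t (Ioo_subset_Icc_self ht))
  refine ⟨ε, hε, fun t => (F (γ t)).re, hsub, ?_, ?_, hmono, ?_, ?_⟩
  · exact fun t ht => (Complex.continuous_re.continuousAt.comp
      (hder t ht).choose_spec.1.continuousAt).continuousWithinAt
  · simp [hz, hF0]
  · intro t ht
    have : ((F (γ t)).re : ℂ) = F (γ t) := by
      apply Complex.ext
      · simp
      · have := him t ht t0 mem0
        simp only [hz, hF0, Complex.zero_im] at this
        simp [this]
    rw [this]
    have h2 := (h ht).1.2
    exact h2.symm
  · intro x hx y hy hxy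
    have : (F (γ x)).re = (F (γ y)).re := by rw [hxy]
    rcases hmono with hm | hm
    · exact hm.injOn hx hy this
    · exact hm.injOn hx hy this

lemma sing_coord {k : ℂ → ℂ} {A : ℂ} (hk : Differentiable ℂ k) (h0 : k A ≠ 0) :
    ∃ (g F ξ : ℂ → ℂ) (r : ℝ), 0 < r ∧ (∀ v ∈ Metric.ball (0:ℂ) r, HasDerivAt F (g v) v) ∧
      (∀ v, g v ^ 2 = 4 * v ^ 4 * k (A + v ^ 2)) ∧ (∀ v, F (-v) = - F v) ∧ F 0 = 0 ∧
      (∀ᶠ v in nhds 0, ξ v ^ 3 = F v ∧ ContinuousAt ξ v) ∧ ∃ p : ℂ, p ≠ 0 ∧ ξ 0 = 0 ∧ HasStrictDerivAt ξ p 0 := by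
  obtain ⟨s, hs, hs0, hsq⟩ := exists_root (hk.analyticAt A) h0 2 two_ne_zero
  set g : ℂ → ℂ := fun v => v ^ 2 * (2 * s (A + v ^ 2)) with hg
  have hs' : AnalyticAt ℂ (fun v : ℂ => 2 * s (A + v ^ 2)) 0 := by
    apply analyticAt_const.mul
    apply AnalyticAt.fun_comp (g := s) (f := fun v : ℂ => A + v ^ 2)
    · simpa using hs
    · fun_prop
  have hga : AnalyticAt ℂ g 0 := by
    apply AnalyticAt.mul (by fun_prop) hs'
  obtain ⟨F0, hF00, r, hr, hF0⟩ := exists_primitive hga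
  set F : ℂ → ℂ := fun v => (F0 v - F0 (-v)) / 2 with hF
  have hFd : ∀ v ∈ Metric.ball (0:ℂ) r, HasDerivAt F (g v) v := by
    intro v hv
    have hv' : -v ∈ Metric.ball (0:ℂ) r := by simpa using hv
    have e := ((hF0 v hv).sub ((hF0 (-v) hv').comp v (hasDerivAt_neg v))).div_const 2
    exact HasDerivAt.congr_deriv (f := F) e (by simp only [hg]; ring_nf)
  have hF0' : F 0 = 0 := by simp [hF]
  have hFa := analyticAt_of_ball hr hFd
  have hord : analyticOrderAt g 0 = (2 : ℕ) := by
    rw [hga.analyticOrderAt_eq_natCast]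
    refine ⟨_, hs', by simpa using hs0, ?_⟩
    filter_upwards with v
    simp [hg]
  have hordF : analyticOrderAt F 0 = (3 : ℕ) := by
    have h1 := hFa.analyticOrderAt_deriv_add_one
    have h2 : analyticOrderAt (deriv F) 0 = analyticOrderAt g 0 := by
      apply analyticOrderAt_congr
      filter_upwards [Metric.ball_mem_nhds (0:ℂ) hr] with v hv
      exact (hFd v hv).deriv
    rw [h2, hord] at h1
    simp only [hF0', sub_zero] at h1
    rw [← h1]; norm_num
  obtain ⟨G, hG, hG0, hFG⟩ := (hFa.analyticOrderAt_eq_natCast).1 hordF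
  obtain ⟨ρ, hρ, hρ0, hρG⟩ := exists_root hG hG0 3 three_ne_zero
  refine ⟨g, F, fun v => v * ρ v, r, hr, hFd, ?_, ?_, hF0', ?_, ρ 0, hρ0, by simp, ?_⟩
  · intro v
    rw [← hsq]; simp only [hg]; ring
  · intro v; simp only [hF, neg_neg]; ring
  · filter_upwards [hFG, hρ.eventually_analyticAt] with v hv hv2
    refine ⟨?_, continuousAt_id.mul hv2.continuousAt⟩
    rw [hv, mul_pow, hρG]; simp
  · have : HasStrictDerivAt (fun v => v * ρ v) (1 * ρ 0 + 0 * deriv ρ 0) 0 :=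
      (hasStrictDerivAt_id (0:ℂ)).mul hρ.hasStrictDerivAt
    simpa only [one_mul, zero_mul, add_zero] using this

/-- square root of a curve emanating from `A`. -/
lemma sqrt_curve {γ : ℝ → ℂ} {A : ℂ} (hc : ContinuousOn γ (Icc 0 1)) (hA : γ 0 = A)
    (hne : ∀ t ∈ Ioo (0:ℝ) 1, γ t ≠ A) :
    ∃ v : ℝ → ℂ, v 0 = 0 ∧ ContinuousOn v (Ico 0 1) ∧ (∀ t ∈ Ico (0:ℝ) 1, v t ^ 2 = γ t - A) ∧
      ∀ t ∈ Ioo (0:ℝ) 1, ∀ d : ℂ, HasDerivAt γ d t → HasDerivAt v (d / (2 * v t)) t := by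
  obtain ⟨φ, hφ, hlift⟩ := lift_arg (convex_Ioo (0:ℝ) 1) (f := fun t => γ t - A)
    ((hc.mono Ioo_subset_Icc_self).sub continuousOn_const) (fun t ht => sub_ne_zero.2 (hne t ht))
  set v : ℝ → ℂ := fun t => (Real.sqrt ‖γ t - A‖ : ℝ) * Complex.exp ((φ t / 2 : ℝ) * I) with hv
  have hv0 : v 0 = 0 := by simp [hv, hA]
  have hsq : ∀ t ∈ Ico (0:ℝ) 1, v t ^ 2 = γ t - A := by
    intro t ht
    rcases ht.1.eq_or_lt with h | h
    · rw [← h, hv0, hA]; simp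
    · have e := hlift t ⟨h, ht.2⟩
      rw [e]
      simp only [hv, mul_pow]
      rw [← Complex.ofReal_pow, Real.sq_sqrt (norm_nonneg _), ← Complex.exp_nat_mul]
      congr 2
      push_cast; ring
  have hvn : ∀ t, ‖v t‖ = Real.sqrt ‖γ t - A‖ := by
    intro t
    simp only [hv]
    rw [norm_mul, Complex.norm_exp_ofReal_mul_I, mul_one, Complex.norm_real, Real.norm_of_nonneg (Real.sqrt_nonneg _)]
  have hcv : ContinuousOn v (Ioo 0 1) := by
    have : ContinuousOn (fun t => Real.sqrt ‖γ t - A‖) (Ioo 0 1) :=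
      Real.continuous_sqrt.comp_continuousOn
        ((hc.mono Ioo_subset_Icc_self).sub continuousOn_const).norm
    apply ContinuousOn.mul
    · exact Complex.continuous_ofReal.comp_continuousOn this
    · apply Complex.continuous_exp.comp_continuousOn
      apply ContinuousOn.mul _ continuousOn_const
      exact Complex.continuous_ofReal.comp_continuousOn (hφ.div_const 2)
  refine ⟨v, hv0, ?_, hsq, ?_⟩
  · intro t ht
    rcases ht.1.eq_or_lt with h | h
    · subst h
      have : Filter.Tendsto (fun t => ‖v t‖) (nhdsWithin 0 (Ico 0 1)) (nhds 0) := by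
        have h1 : ContinuousWithinAt (fun t => Real.sqrt ‖γ t - A‖) (Ico 0 1) 0 :=
          Real.continuous_sqrt.continuousAt.comp_continuousWithinAt
            (((hc 0 (by simp)).mono Ico_subset_Icc_self).sub continuousWithinAt_const).norm
        have h2 : Filter.Tendsto _ _ _ := h1
        simp only [hA, sub_self, norm_zero, Real.sqrt_zero] at h2
        simpa only [hvn] using h2
      have h3 : Filter.Tendsto v (nhdsWithin 0 (Ico 0 1)) (nhds 0) := tendsto_zero_iff_norm_tendsto_zero.2 this
      change Filter.Tendsto _ _ _
      rwa [hv0]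
    · exact (hcv.continuousAt (Ioo_mem_nhds h ht.2)).continuousWithinAt
  · intro t ht d hd
    have hvt : v t ≠ 0 := by
      intro h
      have := hsq t ⟨ht.1.le, ht.2⟩
      rw [h] at this
      exact sub_ne_zero.2 (hne t ht) (by simpa using this.symm)
    have hct : ContinuousAt v t := hcv.continuousAt (Ioo_mem_nhds ht.1 ht.2)
    rw [hasDerivAt_iff_tendsto_slope] at hd ⊢
    have hsum : Filter.Tendsto (fun y => v y + v t) (nhdsWithin t {t}ᶜ) (nhds (2 * v t)) := by
      rw [two_mul]
      exact (hct.tendsto.add tendsto_const_nhds).mono_left nhdsWithin_le_nhds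
    have h2 := hd.div hsum (by simpa using hvt)
    refine h2.congr' ?_
    have ev : ∀ᶠ y in nhdsWithin t {t}ᶜ, v y + v t ≠ 0 := hsum.eventually_ne (by simpa using hvt)
    filter_upwards [ev, nhdsWithin_le_nhds (Ioo_mem_nhds ht.1 ht.2)] with y hy hy2
    simp only [slope, vsub_eq_sub, Pi.div_apply]
    have e : γ y - γ t = (v y - v t) * (v y + v t) := by
      have h1 := hsq y ⟨hy2.1.le, hy2.2⟩
      have h2 := hsq t ⟨ht.1.le, ht.2⟩
      linear_combination h2 - h1
    rw [e, div_eq_iff hy, smul_mul_assoc]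


lemma cubic_root_const {u : ℝ → ℂ} {s : Set ℝ} (hs : IsPreconnected s) (hu : ContinuousOn u s)
    (h : ∀ t ∈ s, u t ^ 3 = 1) : ∀ x ∈ s, ∀ y ∈ s, u x = u y := by
  have hfin : ({z : ℂ | z ^ 3 = 1}).Finite := by
    refine Set.Finite.subset (Finset.finite_toSet (Polynomial.nthRootsFinset 3 (1:ℂ))) ?_
    intro z hz
    simp only [Finset.mem_coe]
    exact (Polynomial.mem_nthRootsFinset (by norm_num) _).2 hz
  intro x hx y hy
  refine hfin.countable.isTotallyDisconnected (u '' s) ?_ (hs.image u hu)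
    (mem_image_of_mem _ hx) (mem_image_of_mem _ hy)
  rintro _ ⟨t, ht, rfl⟩
  exact h t ht

lemma sing {q k : ℂ → ℂ} {A : ℂ} (hk : Differentiable ℂ k) (h0 : k A ≠ 0)
    (hqk : ∀ z, q z = (z - A) * k z) :
    ∃ (ψ : ℂ → ℂ) (p : ℂ), p ≠ 0 ∧ ψ 0 = 0 ∧ HasStrictDerivAt ψ p 0 ∧
      ∀ γ : ℝ → ℂ, IsArc q γ → γ 0 = A → ∃ ε, 0 < ε ∧ ε < 1 ∧ ∃ (e : ℂ) (τ : ℝ → ℝ),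
        e ^ 3 = 1 ∧ ContinuousOn τ (Icc 0 ε) ∧ StrictMonoOn τ (Icc 0 ε) ∧ τ 0 = 0 ∧
        ∀ t ∈ Icc (0:ℝ) ε, γ t = A + ψ (e * τ t) ^ 2 := by
  obtain ⟨g, F, ξ, r, hr, hF, hg, hodd, hF0, hξ, p, hp, hξ0, hst⟩ := sing_coord hk h0
  have hψ := hst.to_localInverse hp
  have hleft := hst.eventually_left_inverse hp
  set ψ := hst.localInverse ξ p 0 hp with hψdef
  rw [hξ0] at hψ
  refine ⟨ψ, p⁻¹, inv_ne_zero hp, ?_, hψ, ?_⟩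
  · have := hleft.self_of_nhds
    rwa [hξ0] at this
  intro γ hγ hA
  have hne : ∀ t ∈ Ioo (0:ℝ) 1, γ t ≠ A := by
    intro t ht h
    apply hγ.ne t ht
    rw [hqk, h]; simp
  obtain ⟨v, hv0, hvc, hvsq, hvd⟩ := sqrt_curve hγ.1 hA hne
  have ev1 : ∀ᶠ z in nhds (0:ℂ), z ∈ Metric.ball (0:ℂ) r ∧ (ξ z ^ 3 = F z ∧ ContinuousAt ξ z) ∧ ψ (ξ z) = z :=
    Filter.Eventually.and (Metric.ball_mem_nhds 0 hr) (hξ.and hleft)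
  have ev2 : ∀ᶠ z in nhds (0:ℂ), -z ∈ Metric.ball (0:ℂ) r ∧ (ξ (-z) ^ 3 = F (-z) ∧ ContinuousAt ξ (-z)) ∧
      ψ (ξ (-z)) = -z := by
    have : Filter.Tendsto (fun z : ℂ => -z) (nhds 0) (nhds 0) := by
      simpa using (continuous_neg (G := ℂ)).tendsto 0
    exact this.eventually ev1
  have hvt : Filter.Tendsto v (nhdsWithin 0 (Ico 0 1)) (nhds 0) := by
    have := hvc 0 (by simp)
    rwa [ContinuousWithinAt, hv0] at this
  obtain ⟨δ, hδ, hδ'⟩ := Metric.nhdsWithin_basis_ball.eventually_iff.1 (hvt.eventually (ev1.and ev2))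
  obtain ⟨ε, hε, hε1, hεδ⟩ : ∃ ε : ℝ, 0 < ε ∧ ε < 1 ∧ ε < δ :=
    ⟨min (1/2) (δ/2), by positivity, by linarith [min_le_left (1/2) (δ/2)],
      by linarith [min_le_right (1/2) (δ/2)]⟩
  have hgood : ∀ t ∈ Icc (0:ℝ) ε, _ := fun t ht => hδ' (x := t) ⟨by
    rw [Metric.mem_ball, Real.dist_eq, sub_zero, abs_of_nonneg ht.1]; linarith [ht.2],
    ht.1, by linarith [ht.2]⟩
  have hsub : Icc 0 ε ⊆ Ico (0:ℝ) 1 := fun t ht => ⟨ht.1, by linarith [ht.2]⟩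
  have hder : ∀ t ∈ Ioo 0 ε, ∃ d : ℂ, HasDerivAt (fun t => F (v t)) d t ∧
      ∃ r : ℝ, 0 < r ∧ d ^ 2 = r := by
    intro t ht
    have ht' : t ∈ Ioo (0:ℝ) 1 := ⟨ht.1, by linarith [ht.2]⟩
    have htc := Ioo_subset_Icc_self ht
    obtain ⟨d, hd, r', hr', e⟩ := hγ.2 t ht'
    refine ⟨g (v t) * (d / (2 * v t)), ?_, r', hr', ?_⟩
    · exact (hF _ (hgood t htc).1.1).comp t (hvd t ht' d hd)
    · have e2 := hvsq t (hsub htc)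
      have e3 : A + v t ^ 2 = γ t := by rw [e2]; ring
      have hv : v t ≠ 0 := by
        intro h
        rw [h] at e2
        exact sub_ne_zero.2 (hne t ht') (by simpa using e2.symm)
      rw [← e, hqk, ← e2, mul_pow, hg, e3]
      field_simp
      ring
  have hcF : ContinuousOn (fun t => F (v t)) (Icc 0 ε) := by
    intro t ht
    exact ((hF _ (hgood t ht).1.1).continuousAt).comp_continuousWithinAt ((hvc t (hsub ht)).mono hsub)
  obtain ⟨him, hmono⟩ := real_deriv hcF hder
  have z0 : (0:ℝ) ∈ Icc 0 ε := ⟨le_rfl, hε.le⟩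
  have him0 : ∀ t ∈ Icc (0:ℝ) ε, (F (v t)).im = 0 := by
    intro t ht
    rw [him t ht 0 z0, hv0, hF0]; simp
  obtain ⟨w, hw0, hwc, hwsq, hwg, hwF, hwm⟩ : ∃ w : ℝ → ℂ, w 0 = 0 ∧ ContinuousOn w (Icc 0 ε) ∧
      (∀ t ∈ Icc (0:ℝ) ε, w t ^ 2 = γ t - A) ∧
      (∀ t ∈ Icc (0:ℝ) ε, (ξ (w t) ^ 3 = F (w t) ∧ ContinuousAt ξ (w t)) ∧ ψ (ξ (w t)) = w t) ∧
      (∀ t ∈ Icc (0:ℝ) ε, (F (w t)).im = 0) ∧ StrictMonoOn (fun t => (F (w t)).re) (Icc 0 ε) := by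
    rcases hmono with hm | hm
    · exact ⟨v, hv0, hvc.mono hsub, fun t ht => hvsq t (hsub ht), fun t ht => (hgood t ht).1.2, him0, hm⟩
    · refine ⟨fun t => - v t, by simp [hv0], (hvc.mono hsub).neg, fun t ht => ?_,
        fun t ht => (hgood t ht).2.2, fun t ht => ?_, ?_⟩
      · rw [← hvsq t (hsub ht)]; ring
      · simp only [hodd, Complex.neg_im, him0 t ht, neg_zero]
      · intro x hx y hy hxy
        simp only [hodd, Complex.neg_re]
        exact neg_lt_neg (hm hx hy hxy)
  have hx0 : (F (w 0)).re = 0 := by rw [hw0, hF0]; simp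
  have hxnn : ∀ t ∈ Icc (0:ℝ) ε, 0 ≤ (F (w t)).re := by
    intro t ht
    rw [← hx0]
    exact hwm.monotoneOn z0 ht ht.1
  have hcube : ∀ t ∈ Icc (0:ℝ) ε, ξ (w t) ^ 3 = ((F (w t)).re : ℂ) := by
    intro t ht
    rw [(hwg t ht).1.1]
    apply Complex.ext <;> simp [hwF t ht]
  have hτ3 : ∀ t ∈ Icc (0:ℝ) ε, ‖ξ (w t)‖ ^ 3 = (F (w t)).re := by
    intro t ht
    rw [← norm_pow, hcube t ht, Complex.norm_real, Real.norm_of_nonneg (hxnn t ht)]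
  have hξc : ContinuousOn (fun t => ξ (w t)) (Icc 0 ε) := fun t ht =>
    (hwg t ht).1.2.comp_continuousWithinAt (hwc t ht)
  have hτm : StrictMonoOn (fun t => ‖ξ (w t)‖) (Icc 0 ε) := by
    intro x hx y hy hxy
    apply lt_of_pow_lt_pow_left₀ 3 (norm_nonneg _)
    rw [hτ3 x hx, hτ3 y hy]
    exact hwm hx hy hxy
  have hτ0 : ‖ξ (w 0)‖ = 0 := by rw [hw0, hξ0]; simp
  have hpos : ∀ t ∈ Ioc (0:ℝ) ε, (‖ξ (w t)‖ : ℂ) ≠ 0 := by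
    intro t ht
    have := hτm z0 (Ioc_subset_Icc_self ht) ht.1
    simp only [hτ0] at this
    exact_mod_cast this.ne'
  have hconst := cubic_root_const (u := fun t => ξ (w t) / (‖ξ (w t)‖ : ℂ)) (s := Ioc 0 ε)
    isPreconnected_Ioc
    ((hξc.mono Ioc_subset_Icc_self).div (Complex.continuous_ofReal.comp_continuousOn
      (hξc.mono Ioc_subset_Icc_self).norm) hpos)
    (by
      intro t ht
      have htc := Ioc_subset_Icc_self ht
      rw [div_pow, hcube t htc, ← Complex.ofReal_pow, hτ3 t htc, div_self]
      rw [← hτ3 t htc]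
      push_cast
      exact pow_ne_zero 3 (hpos t ht))
  have mε : ε ∈ Ioc 0 ε := ⟨hε, le_rfl⟩
  refine ⟨ε, hε, hε1, ξ (w ε) / (‖ξ (w ε)‖ : ℂ), fun t => ‖ξ (w t)‖, ?_, hξc.norm, hτm, hτ0, ?_⟩
  · have htc := Ioc_subset_Icc_self mε
    rw [div_pow, hcube ε htc, ← Complex.ofReal_pow, hτ3 ε htc, div_self]
    rw [← hτ3 ε htc]
    push_cast
    exact pow_ne_zero 3 (hpos ε mε)
  · intro t ht
    have e : ξ (w ε) / (‖ξ (w ε)‖ : ℂ) * (‖ξ (w t)‖ : ℂ) = ξ (w t) := by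
      rcases ht.1.eq_or_lt with h | h
      · rw [← h, hτ0, hw0, hξ0]; simp
      · have := hconst ε mε t ⟨h, ht.2⟩
        rw [this, div_mul_cancel₀ _ (hpos t ⟨h, ht.2⟩)]
    rw [e, (hwg t ht).2, hwsq t ht]; ring

lemma cover {q : ℂ → ℂ} (hq : Differentiable ℂ q) {γ₁ γ₂ : ℝ → ℂ} (h1 : IsArc q γ₁) (h2 : IsArc q γ₂)
    {t₁ t₂ : ℝ} (ht₁ : t₁ ∈ Ioo (0:ℝ) 1) (ht₂ : t₂ ∈ Ioo (0:ℝ) 1) (he : γ₁ t₁ = γ₂ t₂)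
    {η : ℝ} (hη : 0 < η) :
    ∀ᶠ t in nhds t₁, ∃ t' ∈ Ioo (0:ℝ) 1, |t' - t₂| < η ∧ γ₁ t = γ₂ t' := by
  obtain ⟨G, ω, -, -, H⟩ := reg hq (h2.ne t₂ ht₂)
  obtain ⟨ε₁, hε₁, σ₁, -, hc1, h01, -, hG1, -⟩ := H γ₁ t₁ h1 ht₁ he
  obtain ⟨ε₂, hε₂, σ₂, hs2, hc2, h02, hm2, hG2, -⟩ := H γ₂ t₂ h2 ht₂ rfl
  have hδ : 0 < min (η / 2) ε₂ := by positivity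
  set δ := min (η / 2) ε₂ with hδdef
  have hδ1 : δ ≤ η / 2 := min_le_left _ _
  have hδ2 : δ ≤ ε₂ := min_le_right _ _
  have hsub : Icc (t₂ - δ) (t₂ + δ) ⊆ Icc (t₂ - ε₂) (t₂ + ε₂) := Icc_subset_Icc (by linarith) (by linarith)
  have m0 : t₂ ∈ Icc (t₂ - ε₂) (t₂ + ε₂) := ⟨by linarith, by linarith⟩
  have mm : t₂ - δ ∈ Icc (t₂ - ε₂) (t₂ + ε₂) := ⟨by linarith, by linarith⟩
  have mp : t₂ + δ ∈ Icc (t₂ - ε₂) (t₂ + ε₂) := ⟨by linarith, by linarith⟩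
  have hivt := intermediate_value_uIcc (f := σ₂) (a := t₂ - δ) (b := t₂ + δ)
    (by rw [uIcc_of_le (by linarith)]; exact hc2.mono hsub)
  rw [uIcc_of_le (show t₂ - δ ≤ t₂ + δ by linarith)] at hivt
  have hnb : uIcc (σ₂ (t₂ - δ)) (σ₂ (t₂ + δ)) ∈ nhds (0:ℝ) := by
    rcases hm2 with hm | hm
    · have e1 := hm mm m0 (by linarith)
      have e2 := hm m0 mp (by linarith)
      rw [h02] at e1 e2
      rw [uIcc_of_le (by linarith)]
      exact Icc_mem_nhds e1 e2
    · have e1 := hm mm m0 (by linarith)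
      have e2 := hm m0 mp (by linarith)
      rw [h02] at e1 e2
      rw [uIcc_of_ge (by linarith)]
      exact Icc_mem_nhds e2 e1
  have hn1 : Icc (t₁ - ε₁) (t₁ + ε₁) ∈ nhds t₁ := Icc_mem_nhds (by linarith) (by linarith)
  have hct : ContinuousAt σ₁ t₁ := hc1.continuousAt hn1
  have hct' : Filter.Tendsto σ₁ (nhds t₁) (nhds 0) := h01 ▸ hct.tendsto
  filter_upwards [hct'.eventually hnb, hn1] with t ht ht'
  obtain ⟨t', m, e⟩ := hivt ht
  refine ⟨t', hs2 (hsub m), ?_, ?_⟩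
  · rw [abs_lt]; constructor <;> linarith [m.1, m.2]
  · rw [hG1 t ht', hG2 t' (hsub m), e]

lemma arc_closure {γ : ℝ → ℂ} (hc : ContinuousOn γ (Icc 0 1)) {J : Set ℂ} (hJ : IsClosed J)
    (h : ∀ t ∈ Ioo (0:ℝ) 1, γ t ∈ J) : ∀ t ∈ Icc (0:ℝ) 1, γ t ∈ J := by
  intro t ht
  have e : closure (Ioo (0:ℝ) 1) = Icc 0 1 := closure_Ioo (by norm_num)
  have hx : t ∈ closure (Ioo (0:ℝ) 1) := by rwa [e]
  have h1 : MapsTo γ (Ioo (0:ℝ) 1) J := h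
  have := h1.closure_of_continuousOn (by rwa [e]) hx
  rwa [hJ.closure_eq] at this

lemma disj_aux {q : ℂ → ℂ} (hq : Differentiable ℂ q) {γ₁ γ₂ : ℝ → ℂ} (h1 : IsArc q γ₁) (h2 : IsArc q γ₂)
    (z20 : q (γ₂ 0) = 0) (z21 : q (γ₂ 1) = 0)
    {t₁ t₂ : ℝ} (ht₁ : t₁ ∈ Ioo (0:ℝ) 1) (ht₂ : t₂ ∈ Ioo (0:ℝ) 1) (he : γ₁ t₁ = γ₂ t₂)
    {x : ℝ} (hx : x ∈ Icc (0:ℝ) 1) (hqx : q (γ₁ x) = 0) : γ₁ x = γ₂ 0 ∨ γ₁ x = γ₂ 1 := by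
  have hJ : IsClosed (γ₂ '' Icc 0 1) := (isCompact_Icc.image_of_continuousOn h2.1).isClosed
  have key : Ioo (0:ℝ) 1 ⊆ {t | t ∈ Ioo (0:ℝ) 1 ∧ ∃ t' ∈ Ioo (0:ℝ) 1, γ₁ t = γ₂ t'} := by
    apply isPreconnected_Ioo.subset_of_closure_inter_subset
    · rw [isOpen_iff_mem_nhds]
      rintro t ⟨ht, t', ht', e⟩
      filter_upwards [cover hq h1 h2 ht ht' e one_pos, Ioo_mem_nhds ht.1 ht.2] with u hu hu'
      obtain ⟨u', m, -, e⟩ := hu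
      exact ⟨hu', u', m, e⟩
    · exact ⟨t₁, ht₁, ht₁, t₂, ht₂, he⟩
    · rintro t ⟨htc, ht⟩
      refine ⟨ht, ?_⟩
      have hm : γ₁ t ∈ γ₂ '' Icc 0 1 := by
        have hct : ContinuousAt γ₁ t := (h1.2 t ht).choose_spec.1.continuousAt
        have := mem_closure_iff_clusterPt.1 htc
        have h3 := (hct.continuousWithinAt (s := {t | t ∈ Ioo (0:ℝ) 1 ∧ ∃ t' ∈ Ioo (0:ℝ) 1, γ₁ t = γ₂ t'})).mem_closure htc
          (t := γ₂ '' Icc 0 1) (by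
            rintro u ⟨-, u', m, e⟩
            exact ⟨u', Ioo_subset_Icc_self m, e.symm⟩)
        rwa [hJ.closure_eq] at h3
      obtain ⟨t', m, e⟩ := hm
      refine ⟨t', ⟨lt_of_le_of_ne m.1 ?_, lt_of_le_of_ne m.2 ?_⟩, e.symm⟩
      · rintro rfl; exact h1.ne t ht (by rw [← e, z20])
      · rintro rfl; exact h1.ne t ht (by rw [← e, z21])
  obtain ⟨t', m, e⟩ := arc_closure h1.1 hJ (fun t ht => by
    obtain ⟨-, t', m, e⟩ := key ht
    exact ⟨t', Ioo_subset_Icc_self m, e.symm⟩) x hx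
  rcases m.1.eq_or_lt with h | h
  · left; rw [h]; exact e.symm
  rcases m.2.eq_or_lt with h' | h'
  · right; rw [← h']; exact e.symm
  exact absurd (e ▸ hqx) (h2.ne t' ⟨h, h'⟩)

lemma uIcc_two {a b : ℝ} (h : a * b < 0) : uIcc 0 a ∪ uIcc 0 b ∈ nhds (0:ℝ) := by
  rcases mul_neg_iff.1 h with ⟨h1, h2⟩ | ⟨h1, h2⟩
  · filter_upwards [Icc_mem_nhds h2 h1] with x hx
    rcases le_total 0 x with h | h
    · left; rw [uIcc_of_le h1.le]; exact ⟨h, hx.2⟩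
    · right; rw [uIcc_of_ge h2.le]; exact ⟨hx.1, h⟩
  · filter_upwards [Icc_mem_nhds h1 h2] with x hx
    rcases le_total 0 x with h | h
    · right; rw [uIcc_of_le h2.le]; exact ⟨h, hx.2⟩
    · left; rw [uIcc_of_ge h1.le]; exact ⟨hx.1, h⟩

lemma uIcc_common {a b : ℝ} (h : 0 < a * b) : ∃ y, y ≠ 0 ∧ y ∈ uIcc 0 a ∧ y ∈ uIcc 0 b := by
  rcases mul_pos_iff.1 h with ⟨h1, h2⟩ | ⟨h1, h2⟩
  · refine ⟨min a b, (lt_min h1 h2).ne', ?_, ?_⟩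
    · rw [uIcc_of_le h1.le]; exact ⟨(lt_min h1 h2).le, min_le_left _ _⟩
    · rw [uIcc_of_le h2.le]; exact ⟨(lt_min h1 h2).le, min_le_right _ _⟩
  · refine ⟨max a b, (max_lt h1 h2).ne, ?_, ?_⟩
    · rw [uIcc_of_ge h1.le]; exact ⟨le_max_left _ _, (max_lt h1 h2).le⟩
    · rw [uIcc_of_ge h2.le]; exact ⟨le_max_right _ _, (max_lt h1 h2).le⟩

lemma arc_inj {q : ℂ → ℂ} (hq : Differentiable ℂ q) {γ : ℝ → ℂ} (h : IsArc q γ) (z0 : q (γ 0) = 0) :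
    InjOn γ (Ioo 0 1) := by
  suffices hs : ∀ s ∈ Ioo (0:ℝ) 1, ∀ t ∈ Ioo (0:ℝ) 1, s < t → γ s ≠ γ t by
    intro s hs' t ht e
    rcases lt_trichotomy s t with h | h | h
    · exact absurd e (hs s hs' t ht h)
    · exact h
    · exact absurd e.symm (hs t ht s hs' h)
  intro s0 hs0 t0 ht0 hst0 he0
  have hsub : Icc s0 t0 ⊆ Ioo 0 1 := fun x hx => ⟨by linarith [hx.1, hs0.1], by linarith [hx.2, ht0.2]⟩
  have hcont : ∀ x ∈ Ioo (0:ℝ) 1, ContinuousAt γ x := fun x hx => (h.2 x hx).choose_spec.1.continuousAt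
  set K : Set (ℝ × ℝ) := {x | x ∈ Icc s0 t0 ×ˢ Icc s0 t0 ∧ x.1 < x.2 ∧ γ x.1 = γ x.2} with hK
  have hKc : IsCompact K := by
    apply (isCompact_Icc.prod isCompact_Icc).of_isClosed_subset _ (fun x hx => hx.1)
    rw [← isOpen_compl_iff, isOpen_iff_mem_nhds]
    rintro ⟨x, y⟩ hxy
    by_cases hm : (x, y) ∈ Icc s0 t0 ×ˢ Icc s0 t0
    swap
    · filter_upwards [(isClosed_Icc.prod isClosed_Icc).isOpen_compl.mem_nhds hm] with w hw hw'
      exact hw hw'.1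
    rcases lt_trichotomy x y with hlt | heq | hgt
    · have hne : γ x ≠ γ y := fun e => hxy ⟨hm, hlt, e⟩
      have c1 : ContinuousAt (fun w : ℝ × ℝ => γ w.1) (x, y) :=
        ContinuousAt.comp (f := Prod.fst) (g := γ) (x := (x, y)) (hcont x (hsub hm.1)) continuousAt_fst
      have c2 : ContinuousAt (fun w : ℝ × ℝ => γ w.2) (x, y) :=
        ContinuousAt.comp (f := Prod.snd) (g := γ) (x := (x, y)) (hcont y (hsub hm.2)) continuousAt_snd
      filter_upwards [(c1.sub c2).tendsto.eventually_ne (sub_ne_zero.2 hne)] with w hw hw'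
      exact hw (sub_eq_zero.2 hw'.2.2)
    · subst heq
      obtain ⟨G, ω, -, -, H⟩ := reg hq (h.ne x (hsub hm.1))
      obtain ⟨ε, hε, σ, -, -, -, -, -, hinj⟩ := H γ x h (hsub hm.1) rfl
      have hn : Icc (x - ε) (x + ε) ∈ nhds x := Icc_mem_nhds (by linarith) (by linarith)
      filter_upwards [prod_mem_nhds hn hn] with w hw hw'
      exact hw'.2.1.ne (hinj hw.1 hw.2 hw'.2.2)
    · have := (isOpen_lt continuous_snd continuous_fst).mem_nhds (x := ((x, y) : ℝ × ℝ)) hgt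
      filter_upwards [this] with w hw hw'
      exact lt_asymm hw hw'.2.1
  obtain ⟨⟨s, t⟩, hstK, hmin⟩ := hKc.exists_isMinOn
    ⟨(s0, t0), ⟨⟨left_mem_Icc.2 hst0.le, right_mem_Icc.2 hst0.le⟩, hst0, he0⟩⟩
    (f := fun x : ℝ × ℝ => x.2 - x.1) (by fun_prop)
  obtain ⟨⟨hs, ht⟩, hst, he⟩ := hstK
  simp only at hs ht hst he
  have hs1 := hsub hs
  have ht1 := hsub ht
  obtain ⟨G, ω, -, -, H⟩ := reg hq (h.ne s hs1)
  obtain ⟨ε₁, hε₁, σ₁, -, hc1, h01, hm1, hG1, -⟩ := H γ s h hs1 rfl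
  obtain ⟨ε₂, hε₂, σ₂, -, hc2, h02, hm2, hG2, -⟩ := H γ t h ht1 he.symm
  have inj1 : InjOn σ₁ (Icc (s - ε₁) (s + ε₁)) := by
    rcases hm1 with h | h
    · exact h.injOn
    · exact h.injOn
  have inj2 : InjOn σ₂ (Icc (t - ε₂) (t + ε₂)) := by
    rcases hm2 with h | h
    · exact h.injOn
    · exact h.injOn
  obtain ⟨δ, hδ, hδ1, hδ2, hδ3⟩ : ∃ δ : ℝ, 0 < δ ∧ δ ≤ ε₁ ∧ δ ≤ ε₂ ∧ 2 * δ < t - s := by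
    refine ⟨min (min ε₁ ε₂) ((t - s) / 3), ?_, ?_, ?_, ?_⟩
    · have : 0 < t - s := by linarith
      positivity
    · exact (min_le_left _ _).trans (min_le_left _ _)
    · exact (min_le_left _ _).trans (min_le_right _ _)
    · linarith [min_le_right (min ε₁ ε₂) ((t - s) / 3)]
  have sub1 : Icc s (s + δ) ⊆ Icc (s - ε₁) (s + ε₁) := Icc_subset_Icc (by linarith) (by linarith)
  have sub2 : Icc (t - δ) t ⊆ Icc (t - ε₂) (t + ε₂) := Icc_subset_Icc (by linarith) (by linarith)
  have ivt1 := intermediate_value_uIcc (f := σ₁) (a := s) (b := s + δ)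
    (by rw [uIcc_of_le (by linarith)]; exact hc1.mono sub1)
  have ivt2 := intermediate_value_uIcc (f := σ₂) (a := t) (b := t - δ)
    (by rw [uIcc_of_ge (by linarith)]; exact hc2.mono sub2)
  rw [uIcc_of_le (show s ≤ s + δ by linarith), h01] at ivt1
  rw [uIcc_of_ge (show t - δ ≤ t by linarith), h02] at ivt2
  have ha : σ₁ (s + δ) ≠ 0 := by
    intro e
    have := inj1 (sub1 (right_mem_Icc.2 (by linarith))) (sub1 (left_mem_Icc.2 (by linarith))) (e.trans h01.symm)
    linarith
  have hb : σ₂ (t - δ) ≠ 0 := by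
    intro e
    have := inj2 (sub2 (left_mem_Icc.2 (by linarith))) (sub2 (right_mem_Icc.2 (by linarith))) (e.trans h02.symm)
    linarith
  rcases (mul_ne_zero ha hb).lt_or_gt with hab | hab
  · -- same direction
    have hnb := uIcc_two hab
    have hJ : IsClosed (γ '' Icc s t) :=
      (isCompact_Icc.image_of_continuousOn (h.1.mono
        (fun x hx => ⟨by linarith [hx.1, hs1.1], by linarith [hx.2, ht1.2]⟩))).isClosed
    have hJ0 : ∀ x ∈ Icc s t, q (γ x) ≠ 0 := fun x hx =>
      h.ne x ⟨by linarith [hx.1, hs1.1], by linarith [hx.2, ht1.2]⟩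
    have key : Ioo (0:ℝ) 1 ⊆ {x | x ∈ Ioo (0:ℝ) 1 ∧ γ x ∈ γ '' Icc s t} := by
      apply isPreconnected_Ioo.subset_of_closure_inter_subset
      · rw [isOpen_iff_mem_nhds]
        rintro x ⟨hx, y, hy, e⟩
        have hend : γ x = γ s → {x | x ∈ Ioo (0:ℝ) 1 ∧ γ x ∈ γ '' Icc s t} ∈ nhds x := by
          intro e
          obtain ⟨ε₃, hε₃, σ₃, -, hc3, h03, -, hG3, -⟩ := H γ x h hx e
          have hn : Icc (x - ε₃) (x + ε₃) ∈ nhds x := Icc_mem_nhds (by linarith) (by linarith)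
          have hct : ContinuousAt σ₃ x := hc3.continuousAt hn
          have hct' : Filter.Tendsto σ₃ (nhds x) (nhds 0) := h03 ▸ hct.tendsto
          filter_upwards [hn, hct'.eventually hnb, Ioo_mem_nhds hx.1 hx.2] with u hu hu2 hu3
          refine ⟨hu3, ?_⟩
          rcases hu2 with hu2 | hu2
          · obtain ⟨w, m, e⟩ := ivt1 hu2
            exact ⟨w, ⟨m.1, by linarith [m.2]⟩, by rw [hG3 u hu, hG1 w (sub1 m), e]⟩
          · obtain ⟨w, m, e⟩ := ivt2 hu2
            exact ⟨w, ⟨by linarith [m.1], m.2⟩, by rw [hG3 u hu, hG2 w (sub2 m), e]⟩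
        rcases hy.1.eq_or_lt with h1 | h1
        · exact hend (by rw [h1, e])
        rcases hy.2.eq_or_lt with h2 | h2
        · exact hend (by rw [he, ← h2, e])
        have hy' : y ∈ Ioo (0:ℝ) 1 := ⟨by linarith [hs1.1], by linarith [ht1.2]⟩
        filter_upwards [cover hq h h hx hy' e.symm (lt_min (sub_pos.2 h1) (sub_pos.2 h2)),
          Ioo_mem_nhds hx.1 hx.2] with u hu hu2
        obtain ⟨w, -, m, e⟩ := hu
        refine ⟨hu2, w, ?_, e.symm⟩
        have m1 := (abs_lt.1 (m.trans_le (min_le_left _ _))).1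
        have m2 := (abs_lt.1 (m.trans_le (min_le_right _ _))).2
        exact ⟨by linarith, by linarith⟩
      · exact ⟨s, hs1, hs1, s, left_mem_Icc.2 hst.le, rfl⟩
      · rintro x ⟨hxc, hx⟩
        refine ⟨hx, ?_⟩
        have h3 := ((hcont x hx).continuousWithinAt
          (s := {x | x ∈ Ioo (0:ℝ) 1 ∧ γ x ∈ γ '' Icc s t})).mem_closure hxc
          (t := γ '' Icc s t) (fun u hu => hu.2)
        rwa [hJ.closure_eq] at h3
    obtain ⟨x, hx, e⟩ := arc_closure h.1 hJ (fun x hx => (key hx).2) 0 (by simp)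
    exact hJ0 x hx (by rw [e, z0])
  · -- opposite direction
    obtain ⟨y, hy0, hy1, hy2⟩ := uIcc_common hab
    obtain ⟨s', ms, es⟩ := ivt1 hy1
    obtain ⟨t', mt, et⟩ := ivt2 hy2
    have hs' : s < s' := lt_of_le_of_ne ms.1 (by rintro rfl; exact hy0 (es.symm.trans h01))
    have hlt : s' < t' := by linarith [ms.2, mt.1]
    have hmem : (s', t') ∈ K := by
      refine ⟨⟨⟨?_, ?_⟩, ⟨?_, ?_⟩⟩, hlt, ?_⟩
      · exact hs.1.trans hs'.le
      · exact (hlt.le.trans mt.2).trans ht.2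
      · exact (hs.1.trans hs'.le).trans hlt.le
      · exact mt.2.trans ht.2
      · show γ s' = γ t'
        rw [hG1 s' (sub1 ms), hG2 t' (sub2 mt), es, et]
    have := isMinOn_iff.1 hmin _ hmem
    simp only at this
    linarith [mt.2]

def unitC (z : ℂ) : ℂ := z / (‖z‖ : ℂ)

lemma unit_norm {z : ℂ} (h : z ≠ 0) : ‖unitC z‖ = 1 := by
  unfold unitC
  rw [norm_div, Complex.norm_real, norm_norm, div_self (norm_ne_zero_iff.2 h)]

lemma unit_mul (z w : ℂ) : unitC (z * w) = unitC z * unitC w := by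
  unfold unitC
  rw [norm_mul]; push_cast
  rw [mul_div_mul_comm]

lemma unit_pos {r : ℝ} (h : 0 < r) : unitC (r : ℂ) = 1 := by
  unfold unitC
  rw [Complex.norm_real, Real.norm_of_nonneg h.le, div_self (by exact_mod_cast h.ne')]

lemma unit_neg {r : ℝ} (h : r < 0) : unitC (r : ℂ) = -1 := by
  unfold unitC
  have h' : (r : ℂ) ≠ 0 := by exact_mod_cast h.ne
  rw [Complex.norm_real, Real.norm_of_nonpos h.le]
  push_cast
  rw [div_neg, div_self h']

lemma unit_tendsto {α : Type*} {l : Filter α} {f : α → ℂ} {z : ℂ} (h0 : z ≠ 0)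
    (h : Filter.Tendsto f l (nhds z)) : Filter.Tendsto (fun x => unitC (f x)) l (nhds (unitC z)) := by
  unfold unitC
  exact h.div ((Complex.continuous_ofReal.tendsto _).comp h.norm) (by simpa using h0)

lemma eq_norm_unit (z : ℂ) : z = ‖z‖ * unitC z := by
  unfold unitC
  by_cases h : z = 0
  · simp [h]
  · rw [mul_div_cancel₀ _ (by simpa using h)]

def dir (γ : ℝ → ℂ) (p : ℝ × ℝ) : ℂ := unitC (γ p.2 - γ p.1)

def tr0 : Set (ℝ × ℝ) := {p | 0 ≤ p.1 ∧ p.1 < p.2 ∧ p.2 ≤ 1}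

lemma tri_closure : tri ⊆ closure tr0 := by
  intro p hp
  obtain ⟨h1, h2, h3⟩ := hp
  have h0 : (0:ℝ) ∈ closure (Ioo (0:ℝ) 1) := by
    rw [closure_Ioo (by norm_num)]; simp
  have hc : ContinuousWithinAt (fun x : ℝ => (p.1 * (1 - x), p.2 + x * (1 - p.2))) (Ioo 0 1) 0 :=
    (by fun_prop : Continuous (fun x : ℝ => (p.1 * (1 - x), p.2 + x * (1 - p.2)))).continuousWithinAt
  have := hc.mem_closure h0 (t := tr0) (by
    rintro x ⟨hx0, hx1⟩
    refine ⟨?_, ?_, ?_⟩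
    · exact mul_nonneg h1 (by linarith)
    · simp only
      rcases h1.eq_or_lt with h | h
      · rcases h3.eq_or_lt with h' | h'
        · rw [← h, h']; norm_num
        · nlinarith
      · nlinarith
    · simp only; nlinarith)
  simpa using this

lemma slope_lim {G : ℂ → ℂ} {m : ℂ} (hG : HasStrictDerivAt G m 0) {α : Type*} {l : Filter α}
    {x y : α → ℂ} (hx : Filter.Tendsto x l (nhds 0)) (hy : Filter.Tendsto y l (nhds 0))
    (hne : ∀ᶠ a in l, x a ≠ y a) :
    Filter.Tendsto (fun a => (G (x a) - G (y a)) / (x a - y a)) l (nhds m) := by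
  have h1 := hG.isLittleO
  have h2 := (h1.comp_tendsto (hx.prodMk_nhds hy)).tendsto_div_nhds_zero
  have h3 := h2.add_const m
  rw [zero_add] at h3
  refine h3.congr' ?_
  filter_upwards [hne] with a ha
  have := sub_ne_zero.2 ha
  simp [Function.comp]
  field_simp
  ring

lemma dir_lim_interior {q : ℂ → ℂ} (hq : Differentiable ℂ q) {γ : ℝ → ℂ} (h : IsArc q γ)
    {t : ℝ} (ht : t ∈ Ioo (0:ℝ) 1) :
    ∃ y : ℂ, Filter.Tendsto (dir γ) (nhdsWithin (t, t) tr0) (nhds y) ∧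
      ∃ r : ℝ, 0 < r ∧ y ^ 2 * q (γ t) = r := by
  obtain ⟨G, ω, hω, hG, H⟩ := reg hq (h.ne t ht)
  obtain ⟨ε, hε, σ, -, hc, h0, hm, hGσ, -⟩ := H γ t h ht rfl
  have hω0 : ω ≠ 0 := by
    rintro rfl
    exact h.ne t ht (by rw [← hω]; simp)
  have hn : Icc (t - ε) (t + ε) ∈ nhds t := Icc_mem_nhds (by linarith) (by linarith)
  have hct : Filter.Tendsto σ (nhds t) (nhds 0) := h0 ▸ (hc.continuousAt hn).tendsto
  have hct' : Filter.Tendsto (fun s => (σ s : ℂ)) (nhds t) (nhds 0) := by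
    simpa [Function.comp_def] using (Complex.continuous_ofReal.tendsto 0).comp hct
  have l1 : Filter.Tendsto (fun p : ℝ × ℝ => (σ p.1 : ℂ)) (nhdsWithin (t, t) tr0) (nhds 0) :=
    hct'.comp ((continuous_fst.tendsto (t, t)).mono_left nhdsWithin_le_nhds)
  have l2 : Filter.Tendsto (fun p : ℝ × ℝ => (σ p.2 : ℂ)) (nhdsWithin (t, t) tr0) (nhds 0) :=
    hct'.comp ((continuous_snd.tendsto (t, t)).mono_left nhdsWithin_le_nhds)
  have ev : ∀ᶠ p : ℝ × ℝ in nhdsWithin (t, t) tr0, p.1 < p.2 ∧ p.1 ∈ Icc (t - ε) (t + ε) ∧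
      p.2 ∈ Icc (t - ε) (t + ε) := by
    filter_upwards [self_mem_nhdsWithin, nhdsWithin_le_nhds (prod_mem_nhds hn hn)] with p hp hp2
    exact ⟨hp.2.1, hp2.1, hp2.2⟩
  obtain ⟨κ, hκ, hκ2⟩ : ∃ κ : ℂ, κ ^ 2 = 1 ∧ ∀ x ∈ Icc (t - ε) (t + ε), ∀ y ∈ Icc (t - ε) (t + ε),
      x < y → unitC ((σ y - σ x : ℝ) : ℂ) = κ := by
    rcases hm with hm | hm
    · exact ⟨1, by simp, fun x hx y hy hxy => unit_pos (sub_pos.2 (hm hx hy hxy))⟩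
    · exact ⟨-1, by simp, fun x hx y hy hxy => unit_neg (sub_neg.2 (hm hx hy hxy))⟩
  have hinj : InjOn σ (Icc (t - ε) (t + ε)) := by
    rcases hm with h | h
    · exact h.injOn
    · exact h.injOn
  have hne : ∀ᶠ p : ℝ × ℝ in nhdsWithin (t, t) tr0, (σ p.2 : ℂ) ≠ σ p.1 := by
    filter_upwards [ev] with p hp e
    exact hp.1.ne' (hinj hp.2.2 hp.2.1 (by exact_mod_cast e))
  have hlim := unit_tendsto (inv_ne_zero hω0) (slope_lim hG l2 l1 hne)
  refine ⟨unitC ω⁻¹ * κ, ?_, ‖ω‖ ^ 2, by positivity, ?_⟩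
  · refine (hlim.mul_const κ).congr' ?_
    filter_upwards [ev, hne] with p hp hp2
    have := hκ2 p.1 hp.2.1 p.2 hp.2.2 hp.1
    rw [← this, ← unit_mul]
    unfold dir
    rw [hGσ p.2 hp.2.2, hGσ p.1 hp.2.1]
    congr 1
    push_cast
    rw [div_mul_cancel₀ _ (sub_ne_zero.2 hp2)]
  · rw [mul_pow, hκ, mul_one, ← hω]
    have e1 : unitC ω⁻¹ = ω⁻¹ * ‖ω‖ := by
      unfold unitC
      rw [norm_inv]; push_cast; rw [div_inv_eq_mul]
    rw [e1]; push_cast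
    field_simp

lemma sing_lim {ψ : ℂ → ℂ} {p A e : ℂ} (hp : p ≠ 0) (hψ0 : ψ 0 = 0) (hψ : HasStrictDerivAt ψ p 0)
    {γ : ℝ → ℂ} {ε : ℝ} {τ : ℝ → ℝ} (hε : 0 < ε) (he : e ^ 3 = 1)
    (hc : ContinuousOn τ (Icc 0 ε)) (hm : StrictMonoOn τ (Icc 0 ε)) (h0 : τ 0 = 0)
    (hγ : ∀ t ∈ Icc (0:ℝ) ε, γ t = A + ψ (e * τ t) ^ 2) :
    Filter.Tendsto (dir γ) (nhdsWithin (0, 0) tr0) (nhds (unitC (p * e) ^ 2)) := by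
  have he0 : e ≠ 0 := by rintro rfl; norm_num at he
  have i0 : (0:ℝ) ∈ Icc 0 ε := ⟨le_rfl, hε.le⟩
  have ev : ∀ᶠ p : ℝ × ℝ in nhdsWithin (0, 0) tr0, p.1 < p.2 ∧ p.1 ∈ Icc 0 ε ∧ p.2 ∈ Icc 0 ε := by
    have hn : Iio ε ∈ nhds (0:ℝ) := Iio_mem_nhds hε
    filter_upwards [self_mem_nhdsWithin, nhdsWithin_le_nhds (prod_mem_nhds hn hn)] with p hp hp2
    exact ⟨hp.2.1, ⟨hp.1, hp2.1.le⟩, ⟨hp.1.trans hp.2.1.le, hp2.2.le⟩⟩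
  have hτ : Filter.Tendsto τ (nhdsWithin 0 (Icc 0 ε)) (nhds 0) := by
    have := hc 0 i0
    rwa [ContinuousWithinAt, h0] at this
  have hτ' : Filter.Tendsto (fun t => e * (τ t : ℂ)) (nhdsWithin 0 (Icc 0 ε)) (nhds 0) := by
    simpa using ((Complex.continuous_ofReal.tendsto 0).comp hτ).const_mul e
  have f1 : Filter.Tendsto (fun p : ℝ × ℝ => p.1) (nhdsWithin (0, 0) tr0) (nhdsWithin 0 (Icc 0 ε)) :=
    tendsto_nhdsWithin_iff.2 ⟨(continuous_fst.tendsto ((0:ℝ), (0:ℝ))).mono_left nhdsWithin_le_nhds,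
      ev.mono fun p hp => hp.2.1⟩
  have f2 : Filter.Tendsto (fun p : ℝ × ℝ => p.2) (nhdsWithin (0, 0) tr0) (nhdsWithin 0 (Icc 0 ε)) :=
    tendsto_nhdsWithin_iff.2 ⟨(continuous_snd.tendsto ((0:ℝ), (0:ℝ))).mono_left nhdsWithin_le_nhds,
      ev.mono fun p hp => hp.2.2⟩
  have l1 := hτ'.comp f1
  have l2 := hτ'.comp f2
  have hnn : ∀ t ∈ Icc 0 ε, 0 ≤ τ t := fun t ht => by rw [← h0]; exact hm.monotoneOn i0 ht ht.1
  have ev2 : ∀ᶠ p : ℝ × ℝ in nhdsWithin (0, 0) tr0, 0 ≤ τ p.1 ∧ τ p.1 < τ p.2 ∧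
      p.1 ∈ Icc 0 ε ∧ p.2 ∈ Icc 0 ε := by
    filter_upwards [ev] with p hp
    exact ⟨hnn _ hp.2.1, hm hp.2.1 hp.2.2 hp.1, hp.2⟩
  have D := slope_lim hψ l2 l1 (by
    filter_upwards [ev2] with p hp
    simp only [Function.comp, ne_eq, mul_eq_mul_left_iff, he0, or_false]
    exact_mod_cast hp.2.1.ne')
  have hli : (fun z : ℂ => ψ z - z * p) =o[nhds 0] (fun z => z) := by
    have := hψ.hasDerivAt.isLittleO
    simpa [hψ0] using this
  have o1 := hli.comp_tendsto l1
  have o2 := hli.comp_tendsto l2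
  have b1 : (fun p : ℝ × ℝ => e * (τ p.1 : ℂ)) =O[nhdsWithin (0, 0) tr0]
      (fun p : ℝ × ℝ => ((τ p.2 + τ p.1 : ℝ) : ℂ)) := by
    apply Asymptotics.IsBigO.of_bound ‖e‖
    filter_upwards [ev2] with p hp
    rw [norm_mul, Complex.norm_real, Complex.norm_real, Real.norm_of_nonneg hp.1,
      Real.norm_of_nonneg (by linarith [hp.1, hp.2.1])]
    gcongr
    linarith [hp.1, hp.2.1]
  have b2 : (fun p : ℝ × ℝ => e * (τ p.2 : ℂ)) =O[nhdsWithin (0, 0) tr0]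
      (fun p : ℝ × ℝ => ((τ p.2 + τ p.1 : ℝ) : ℂ)) := by
    apply Asymptotics.IsBigO.of_bound ‖e‖
    filter_upwards [ev2] with p hp
    rw [norm_mul, Complex.norm_real, Complex.norm_real, Real.norm_of_nonneg (by linarith [hp.1, hp.2.1]),
      Real.norm_of_nonneg (by linarith [hp.1, hp.2.1])]
    gcongr
    linarith [hp.1, hp.2.1]
  have S := ((o1.trans_isBigO b1).add (o2.trans_isBigO b2)).tendsto_div_nhds_zero.add_const (p * e)
  rw [zero_add] at S
  have S' : Filter.Tendsto (fun x : ℝ × ℝ => (ψ (e * τ x.2) + ψ (e * τ x.1)) / ((τ x.2 + τ x.1 : ℝ) : ℂ))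
      (nhdsWithin (0, 0) tr0) (nhds (p * e)) := by
    refine S.congr' ?_
    filter_upwards [ev2] with x hx
    have : ((τ x.2 + τ x.1 : ℝ) : ℂ) ≠ 0 := by
      have : 0 < τ x.2 + τ x.1 := by linarith [hx.1, hx.2.1]
      exact_mod_cast this.ne'
    simp only [Function.comp]
    field_simp
    push_cast
    ring
  have fin := (unit_tendsto (mul_ne_zero hp he0) (D.mul_const e)).mul (unit_tendsto (mul_ne_zero hp he0) S')
  rw [← pow_two] at fin
  refine fin.congr' ?_
  filter_upwards [ev2] with x hx
  unfold dir
  rw [hγ x.2 hx.2.2.2, hγ x.1 hx.2.2.1, ← unit_mul]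
  have e1 : (τ x.2 : ℂ) - τ x.1 ≠ 0 := by
    have : 0 < τ x.2 - τ x.1 := by linarith [hx.2.1]
    exact_mod_cast this.ne'
  have e2 : (τ x.2 : ℂ) + τ x.1 ≠ 0 := by
    have : 0 < τ x.2 + τ x.1 := by linarith [hx.1, hx.2.1]
    exact_mod_cast this.ne'
  have hpos : 0 < (τ x.2 - τ x.1) * (τ x.2 + τ x.1) :=
    mul_pos (by linarith [hx.2.1]) (by linarith [hx.1, hx.2.1])
  have key : A + ψ (e * τ x.2) ^ 2 - (A + ψ (e * τ x.1) ^ 2) =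
      ((ψ (e * τ x.2) - ψ (e * τ x.1)) / (e * τ x.2 - e * τ x.1) * e *
      ((ψ (e * τ x.2) + ψ (e * τ x.1)) / ((τ x.2 + τ x.1 : ℝ) : ℂ))) *
      (((τ x.2 - τ x.1) * (τ x.2 + τ x.1) : ℝ) : ℂ) := by
    rw [← mul_sub]
    push_cast
    field_simp
    ring
  rw [key, unit_mul _ ((((τ x.2 - τ x.1) * (τ x.2 + τ x.1) : ℝ) : ℂ)), unit_pos hpos, mul_one]
  rfl

lemma corner_lim {q k : ℂ → ℂ} {A : ℂ} (hk : Differentiable ℂ k) (hkA : k A ≠ 0)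
    (hqk : ∀ z, q z = (z - A) * k z) {γ₁ γ₂ : ℝ → ℂ} (h1 : IsArc q γ₁) (h2 : IsArc q γ₂)
    (z1 : γ₁ 0 = A) (z2 : γ₂ 0 = A) :
    ∃ y₁ y₂ : ℂ, Filter.Tendsto (dir γ₁) (nhdsWithin (0, 0) tr0) (nhds y₁) ∧
      Filter.Tendsto (dir γ₂) (nhdsWithin (0, 0) tr0) (nhds y₂) ∧
      (y₁ = y₂ → ∃ t₁ ∈ Ioo (0:ℝ) 1, ∃ t₂ ∈ Ioo (0:ℝ) 1, γ₁ t₁ = γ₂ t₂) := by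
  obtain ⟨ψ, p, hp, hψ0, hψ, H⟩ := sing hk hkA hqk
  obtain ⟨ε₁, hε₁, hε₁', e₁, τ₁, he₁, hc₁, hm₁, h0₁, hγ₁⟩ := H γ₁ h1 z1
  obtain ⟨ε₂, hε₂, hε₂', e₂, τ₂, he₂, hc₂, hm₂, h0₂, hγ₂⟩ := H γ₂ h2 z2
  refine ⟨_, _, sing_lim hp hψ0 hψ hε₁ he₁ hc₁ hm₁ h0₁ hγ₁, sing_lim hp hψ0 hψ hε₂ he₂ hc₂ hm₂ h0₂ hγ₂, ?_⟩
  intro h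
  have n1 : ‖e₁‖ = 1 := Complex.norm_eq_one_of_pow_eq_one he₁ (by norm_num)
  have n2 : ‖e₂‖ = 1 := Complex.norm_eq_one_of_pow_eq_one he₂ (by norm_num)
  have u1 : unitC e₁ = e₁ := by unfold unitC; rw [n1]; simp
  have u2 : unitC e₂ = e₂ := by unfold unitC; rw [n2]; simp
  rw [unit_mul, unit_mul, u1, u2, mul_pow, mul_pow] at h
  have up : unitC p ≠ 0 := by
    intro h
    have := unit_norm hp
    rw [h] at this; simp at this
  have hsq := mul_left_cancel₀ (pow_ne_zero 2 up) h
  have hee : e₁ = e₂ := by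
    calc e₁ = e₁ * e₁ ^ 3 := by rw [he₁, mul_one]
      _ = (e₁ ^ 2) ^ 2 := by ring
      _ = (e₂ ^ 2) ^ 2 := by rw [hsq]
      _ = e₂ * e₂ ^ 3 := by ring
      _ = e₂ := by rw [he₂, mul_one]
  have i1 := intermediate_value_Icc hε₁.le hc₁
  have i2 := intermediate_value_Icc hε₂.le hc₂
  have p1 : 0 < τ₁ ε₁ := by
    rw [← h0₁]; exact hm₁ (left_mem_Icc.2 hε₁.le) (right_mem_Icc.2 hε₁.le) hε₁
  have p2 : 0 < τ₂ ε₂ := by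
    rw [← h0₂]; exact hm₂ (left_mem_Icc.2 hε₂.le) (right_mem_Icc.2 hε₂.le) hε₂
  rw [h0₁] at i1
  rw [h0₂] at i2
  have hy : 0 < min (τ₁ ε₁) (τ₂ ε₂) := lt_min p1 p2
  obtain ⟨t₁, m1, E1⟩ := i1 ⟨hy.le, min_le_left _ _⟩
  obtain ⟨t₂, m2, E2⟩ := i2 ⟨hy.le, min_le_right _ _⟩
  refine ⟨t₁, ⟨lt_of_le_of_ne m1.1 ?_, by linarith [m1.2]⟩, t₂, ⟨lt_of_le_of_ne m2.1 ?_, by linarith [m2.2]⟩, ?_⟩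
  · rintro rfl; rw [h0₁] at E1; exact hy.ne E1
  · rintro rfl; rw [h0₂] at E2; exact hy.ne E2
  · rw [hγ₁ t₁ m1, hγ₂ t₂ m2, E1, E2, hee]

def rev (γ : ℝ → ℂ) : ℝ → ℂ := fun t => γ (1 - t)

lemma IsArc.rev {q : ℂ → ℂ} {γ : ℝ → ℂ} (h : IsArc q γ) : IsArc q (rev γ) := by
  refine ⟨?_, ?_⟩
  · exact h.1.comp (by fun_prop) (fun t ht => ⟨by linarith [ht.2], by linarith [ht.1]⟩)
  · intro t ht
    obtain ⟨d, hd, r, hr, e⟩ := h.2 (1 - t) ⟨by linarith [ht.2], by linarith [ht.1]⟩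
    refine ⟨-d, ?_, r, hr, by rw [neg_sq]; exact e⟩
    exact HasDerivAt.comp_const_sub 1 t hd

lemma dir_rev {γ : ℝ → ℂ} {y : ℂ} (h : Filter.Tendsto (dir (rev γ)) (nhdsWithin (0, 0) tr0) (nhds y)) :
    Filter.Tendsto (dir γ) (nhdsWithin (1, 1) tr0) (nhds (-y)) := by
  have hm : Filter.Tendsto (fun p : ℝ × ℝ => (1 - p.2, 1 - p.1)) (nhdsWithin (1, 1) tr0)
      (nhdsWithin (0, 0) tr0) := by
    rw [tendsto_nhdsWithin_iff]
    constructor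
    · have : Continuous (fun p : ℝ × ℝ => (1 - p.2, 1 - p.1)) := by fun_prop
      have h2 := (this.tendsto (1, 1)).mono_left (nhdsWithin_le_nhds (s := tr0))
      simpa using h2
    · filter_upwards [self_mem_nhdsWithin] with p hp
      obtain ⟨h1, h2, h3⟩ := hp
      exact ⟨by simp only; linarith, by simp only; linarith, by simp only; linarith⟩
  refine (h.comp hm).neg.congr ?_
  intro p
  simp only [Function.comp, dir, rev, sub_sub_cancel]
  unfold unitC
  rw [← neg_div, neg_sub, norm_sub_rev]

def Ud (γ : ℝ → ℂ) : ℝ × ℝ → ℂ := extendFrom tr0 (dir γ)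

lemma Ud_eq {γ : ℝ → ℂ} {p : ℝ × ℝ} {y : ℂ} (hp : p ∈ tri)
    (h : Filter.Tendsto (dir γ) (nhdsWithin p tr0) (nhds y)) : Ud γ p = y :=
  extendFrom_eq (tri_closure hp) h

lemma lim0 {c P Q R : ℂ} (hc : c ≠ 0) (hPQ : P ≠ Q) (hRP : R ≠ P) {q : ℂ → ℂ}
    (hq : ∀ z, q z = c * (z - P) * (z - Q) * (z - R)) {γ₁ γ₂ : ℝ → ℂ} (h1 : IsArc q γ₁) (h2 : IsArc q γ₂)
    (z1 : γ₁ 0 = P) (z2 : γ₂ 0 = P) :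
    ∃ y₁ y₂ : ℂ, Filter.Tendsto (dir γ₁) (nhdsWithin (0, 0) tr0) (nhds y₁) ∧
      Filter.Tendsto (dir γ₂) (nhdsWithin (0, 0) tr0) (nhds y₂) ∧
      (y₁ = y₂ → ∃ t₁ ∈ Ioo (0:ℝ) 1, ∃ t₂ ∈ Ioo (0:ℝ) 1, γ₁ t₁ = γ₂ t₂) := by
  refine corner_lim (k := fun z => c * (z - Q) * (z - R)) (by fun_prop) ?_ ?_ h1 h2 z1 z2
  · exact mul_ne_zero (mul_ne_zero hc (sub_ne_zero.2 hPQ)) (sub_ne_zero.2 hRP.symm)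
  · intro z; rw [hq]; ring

lemma mkArc {c P Q R : ℂ} (hc : c ≠ 0) (hPQ : P ≠ Q) (hQR : Q ≠ R) (hRP : R ≠ P) {q : ℂ → ℂ}
    (hq : ∀ z, q z = c * (z - P) * (z - Q) * (z - R)) {γ : ℝ → ℂ} (h : IsArc q γ)
    (h0 : γ 0 = P) (h1 : γ 1 = Q) : ArcData c P Q R γ (Ud γ) := by
  have hqd : Differentiable ℂ q := by
    rw [show q = _ from funext hq]; fun_prop
  have hP : ∀ t ∈ Ioo (0:ℝ) 1, γ t ≠ P := fun t ht e => h.ne t ht (by rw [hq, e]; ring)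
  have hQ : ∀ t ∈ Ioo (0:ℝ) 1, γ t ≠ Q := fun t ht e => h.ne t ht (by rw [hq, e]; ring)
  have hR : ∀ t ∈ Icc (0:ℝ) 1, γ t ≠ R := by
    intro t ht e
    rcases ht.1.eq_or_lt with h' | h'
    · rw [← h', h0] at e; exact hRP e.symm
    rcases ht.2.eq_or_lt with h'' | h''
    · rw [h'', h1] at e; exact hQR e
    exact h.ne t ⟨h', h''⟩ (by rw [hq, e]; ring)
  have hinj := arc_inj hqd h (by rw [hq, h0]; ring)
  have hinj' : ∀ s t, 0 ≤ s → s < t → t ≤ 1 → γ s ≠ γ t := by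
    intro s t hs hst ht e
    rcases hs.eq_or_lt with h' | h'
    · rw [← h', h0] at e
      rcases ht.eq_or_lt with h'' | h''
      · rw [h'', h1] at e; exact hPQ e
      · exact hP t ⟨by linarith, h''⟩ e.symm
    · rcases ht.eq_or_lt with h'' | h''
      · rw [h'', h1] at e; exact hQ s ⟨h', by linarith⟩ e
      · exact hst.ne (hinj ⟨h', by linarith⟩ ⟨by linarith, h''⟩ e)
  obtain ⟨y0, -, L0, -, -⟩ := lim0 hc hPQ hRP hq h h h0 h0
  obtain ⟨y1, -, L1, -, -⟩ := lim0 (P := Q) (Q := R) (R := P) hc hQR hPQ (fun z => by rw [hq]; ring)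
    h.rev h.rev (by simp [rev, h1]) (by simp [rev, h1])
  have L1' := dir_rev L1
  have hdirc : ∀ p ∈ tr0, Filter.Tendsto (dir γ) (nhdsWithin p tr0) (nhds (dir γ p)) := by
    rintro p hp
    have c1 : ContinuousWithinAt (fun p : ℝ × ℝ => γ p.1) tr0 p := by
      apply ContinuousWithinAt.comp (t := Icc 0 1) (g := γ) (f := Prod.fst)
      · exact h.1 _ ⟨hp.1, by linarith [hp.2.1, hp.2.2]⟩
      · exact continuousWithinAt_fst
      · intro u hu; exact ⟨hu.1, by linarith [hu.2.1, hu.2.2]⟩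
    have c2 : ContinuousWithinAt (fun p : ℝ × ℝ => γ p.2) tr0 p := by
      apply ContinuousWithinAt.comp (t := Icc 0 1) (g := γ) (f := Prod.snd)
      · exact h.1 _ ⟨by linarith [hp.1, hp.2.1], hp.2.2⟩
      · exact continuousWithinAt_snd
      · intro u hu; exact ⟨by linarith [hu.1, hu.2.1], hu.2.2⟩
    exact unit_tendsto (sub_ne_zero.2 (hinj' p.1 p.2 hp.1 hp.2.1 hp.2.2).symm) (c2.sub c1)
  have hlim : ∀ p ∈ tri, ∃ y, Filter.Tendsto (dir γ) (nhdsWithin p tr0) (nhds y) := by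
    rintro ⟨s, t⟩ ⟨a1, a2, a3⟩
    simp only at a1 a2 a3
    rcases a2.eq_or_lt with h' | h'
    · subst h'
      rcases a1.eq_or_lt with h' | h'
      · rw [← h']; exact ⟨_, L0⟩
      rcases a3.eq_or_lt with h'' | h''
      · rw [h'']; exact ⟨_, L1'⟩
      obtain ⟨y, hy, -⟩ := dir_lim_interior hqd h ⟨h', h''⟩
      exact ⟨y, hy⟩
    · exact ⟨_, hdirc (s, t) ⟨a1, h', a3⟩⟩
  refine ⟨h.1, h0, h1, hP, hQ, hR, continuousOn_extendFrom tri_closure hlim, ?_, ?_, ?_⟩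
  · intro p hp
    obtain ⟨y, hy⟩ := hlim p hp
    rw [Ud_eq hp hy]
    have := mem_closure_iff_nhdsWithin_neBot.1 (tri_closure hp)
    refine tendsto_nhds_unique hy.norm (tendsto_const_nhds.congr' ?_)
    filter_upwards [self_mem_nhdsWithin] with u hu
    exact (unit_norm (sub_ne_zero.2 (hinj' u.1 u.2 hu.1 hu.2.1 hu.2.2).symm)).symm
  · intro s t hs hst ht
    rw [Ud_eq (p := (s, t)) ⟨hs, hst.le, ht⟩ (hdirc (s, t) ⟨hs, hst, ht⟩)]
    exact eq_norm_unit _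
  · intro t ht
    obtain ⟨y, hy, r, hr, e⟩ := dir_lim_interior hqd h ht
    rw [Ud_eq (p := (t, t)) ⟨ht.1.le, le_rfl, ht.2.le⟩ hy]
    exact ⟨r, hr, by rw [← e, hq]⟩

lemma pair_disj {c P Q R : ℂ} (hPQ : P ≠ Q) (hQR : Q ≠ R) (hRP : R ≠ P) {q : ℂ → ℂ}
    (hq : ∀ z, q z = c * (z - P) * (z - Q) * (z - R)) {γ₁ γ₂ : ℝ → ℂ} (h1 : IsArc q γ₁) (h2 : IsArc q γ₂)
    (a0 : γ₁ 0 = P) (a1 : γ₁ 1 = Q) (b0 : γ₂ 0 = Q) (b1 : γ₂ 1 = R) :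
    ∀ s ∈ Icc (0:ℝ) 1, ∀ t ∈ Icc (0:ℝ) 1, (s, t) ≠ ((1:ℝ), (0:ℝ)) → γ₁ s ≠ γ₂ t := by
  have hqd : Differentiable ℂ q := by
    rw [show q = _ from funext hq]; fun_prop
  have qP : q P = 0 := by rw [hq]; ring
  have qQ : q Q = 0 := by rw [hq]; ring
  have qR : q R = 0 := by rw [hq]; ring
  have cas : ∀ x ∈ Icc (0:ℝ) 1, x = 0 ∨ x = 1 ∨ x ∈ Ioo (0:ℝ) 1 := by
    intro x hx
    rcases hx.1.eq_or_lt with h | h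
    · exact Or.inl h.symm
    rcases hx.2.eq_or_lt with h' | h'
    · exact Or.inr (Or.inl h')
    · exact Or.inr (Or.inr ⟨h, h'⟩)
  intro s hs t ht hne e
  rcases cas s hs with rfl | rfl | hs'
  · rw [a0] at e
    rcases cas t ht with rfl | rfl | ht'
    · exact hPQ (e.trans b0)
    · exact hRP (e.trans b1).symm
    · exact h2.ne t ht' (by rw [← e, qP])
  · rw [a1] at e
    rcases cas t ht with rfl | rfl | ht'
    · exact hne rfl
    · exact hQR (e.trans b1)
    · exact h2.ne t ht' (by rw [← e, qQ])
  · rcases cas t ht with rfl | rfl | ht'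
    · exact h1.ne s hs' (by rw [e, b0, qQ])
    · exact h1.ne s hs' (by rw [e, b1, qR])
    · rcases disj_aux hqd h1 h2 (by rw [b0, qQ]) (by rw [b1, qR]) hs' ht' e (x := 0) (by simp)
        (by rw [a0, qP]) with h | h
      · exact hPQ (by rw [← a0, h, b0])
      · exact hRP (by rw [← a0, h, b1])

lemma pair_corner {c P Q R : ℂ} (hc : c ≠ 0) (hPQ : P ≠ Q) (hQR : Q ≠ R) {q : ℂ → ℂ}
    (hq : ∀ z, q z = c * (z - P) * (z - Q) * (z - R)) {γ₁ γ₂ : ℝ → ℂ} (h1 : IsArc q γ₁) (h2 : IsArc q γ₂)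
    (a1 : γ₁ 1 = Q) (b0 : γ₂ 0 = Q)
    (hd : ∀ s ∈ Icc (0:ℝ) 1, ∀ t ∈ Icc (0:ℝ) 1, (s, t) ≠ ((1:ℝ), (0:ℝ)) → γ₁ s ≠ γ₂ t) :
    Ud γ₁ (1, 1) + Ud γ₂ (0, 0) ≠ 0 := by
  obtain ⟨y1, y2, L1, L2, H⟩ := lim0 (P := Q) (Q := R) (R := P) hc hQR hPQ (fun z => by rw [hq]; ring)
    h1.rev h2 (by simp [rev, a1]) b0
  rw [Ud_eq (p := (1, 1)) ⟨by norm_num, by norm_num, by norm_num⟩ (dir_rev L1),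
    Ud_eq (p := (0, 0)) ⟨by norm_num, by norm_num, by norm_num⟩ L2]
  intro e
  obtain ⟨t1, m1, t2, m2, E⟩ := H (by linear_combination -e)
  refine hd (1 - t1) ⟨by linarith [m1.2], by linarith [m1.1]⟩ t2 (Ioo_subset_Icc_self m2) ?_ E
  intro h
  have := congrArg Prod.snd h
  simp only at this
  exact m2.1.ne' this

lemma no_triangle {c P Q R : ℂ} (hc : c ≠ 0) (hPQ : P ≠ Q) (hQR : Q ≠ R) (hRP : R ≠ P) {q : ℂ → ℂ}
    (hq : ∀ z, q z = c * (z - P) * (z - Q) * (z - R)) {γ₀ γ₁ γ₂ : ℝ → ℂ}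
    (h0 : IsArc q γ₀) (h1 : IsArc q γ₁) (h2 : IsArc q γ₂)
    (a0 : γ₀ 0 = P) (a1 : γ₀ 1 = Q) (b0 : γ₁ 0 = Q) (b1 : γ₁ 1 = R) (c0 : γ₂ 0 = R) (c1 : γ₂ 1 = P) :
    False := by
  have hq1 : ∀ z, q z = c * (z - Q) * (z - R) * (z - P) := fun z => by rw [hq]; ring
  have hq2 : ∀ z, q z = c * (z - R) * (z - P) * (z - Q) := fun z => by rw [hq]; ring
  have n0 := pair_disj hPQ hQR hRP hq h0 h1 a0 a1 b0 b1
  have n1 := pair_disj hQR hRP hPQ hq1 h1 h2 b0 b1 c0 c1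
  have n2 := pair_disj hRP hPQ hQR hq2 h2 h0 c0 c1 a0 a1
  exact topMain hc hPQ hQR hRP (mkArc hc hPQ hQR hRP hq h0 a0 a1)
    (mkArc hc hQR hRP hPQ hq1 h1 b0 b1) (mkArc hc hRP hPQ hQR hq2 h2 c0 c1) n0 n1 n2
    (pair_corner hc hPQ hQR hq h0 h1 a1 b0 n0) (pair_corner hc hQR hRP hq1 h1 h2 b1 c0 n1)
    (pair_corner hc hRP hPQ hq2 h2 h0 c1 a0 n2)

lemma ShortTraj.arc {θ : ℝ} {a u v : ℂ} (h : ShortTraj θ a u v) :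
    ∃ γ : ℝ → ℂ, IsArc (varpi θ a) γ ∧ γ 0 = u ∧ γ 1 = v := by
  obtain ⟨γ, γ', hc, h0, h1, H⟩ := h
  refine ⟨γ, ⟨hc, fun t ht => ?_⟩, h0, h1⟩
  obtain ⟨hd, -, -, him, hre⟩ := H t ht
  refine ⟨γ' t, hd, _, hre, ?_⟩
  apply Complex.ext
  · simp
  · simpa using him

/-- `ϖ_{a,θ}` has at most two short trajectories connecting two different pairs of
distinct finite critical points: among the three pairs of the zeros `1, -1, a`, not
all three can be joined by short trajectories. -/
theorem stmt13 (θ : ℝ) (a : ℂ) (ha : a ≠ 1 ∧ a ≠ -1) :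
    ¬(ShortTraj θ a 1 (-1) ∧ ShortTraj θ a 1 a ∧ ShortTraj θ a (-1) a) := by
  rintro ⟨A, B, C⟩
  obtain ⟨γ₀, g0, a0, a1⟩ := A.arc
  obtain ⟨γ₂, g2, c1, c0⟩ := B.arc
  obtain ⟨γ₁, g1, b0, b1⟩ := C.arc
  refine no_triangle (c := -Complex.exp (2 * Complex.I * θ)) (P := 1) (Q := -1) (R := a)
    (neg_ne_zero.2 (Complex.exp_ne_zero _)) (by norm_num) ha.2.symm ha.1 (q := varpi θ a) ?_
    g0 g1 g2.rev a0 a1 b0 b1 (by simp [rev, c0]) (by simp [rev, c1])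
  intro z
  unfold varpi
  ring
end
end

section
/- Suppose a quadratic differential ϖ_{a,θ} = -e^{2iθ}(z-a)(z²-1)dz² (a ∉ ℝ, Im a > 0) has a short horizontal trajectory γ connecting z = 1 to z = a. Then γ is entirely contained in the closed upper half-plane. Equivalently, a short trajectory joining a zero on ℝ to the zero a cannot cross the real axis: if γ passed through a real point b with b < -1 or b > 1, then the condition Re∫ over appropriate real subintervals would force both Re(e^{iθ}∫_α^β √(p_a)) = 0 and Re(e^{iθ}∫_γ^δ √(p_a)) = 0 for some α<β≤γ<δ in ℝ, which is impossible. -/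
open Complex Set

noncomputable section

theorem varpi_hasDerivAt (θ : ℝ) (a z : ℂ) (h : (z - a) * (z ^ 2 - 1) ≠ 0) :
    HasDerivAt (varpi θ a)
      (varpi θ a z * ((z - a)⁻¹ + (z - 1)⁻¹ + (z + 1)⁻¹)) z := by
  have e : z ^ 2 - 1 = (z - 1) * (z + 1) := by ring
  rw [e] at h
  have ha : z - a ≠ 0 := fun h' => h (by simp [h'])
  have h1 : z - 1 ≠ 0 := fun h' => h (by simp [h'])
  have h2 : z + 1 ≠ 0 := fun h' => h (by simp [h'])
  have d1 : HasDerivAt (fun z : ℂ => z - a) 1 z := (hasDerivAt_id z).sub_const a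
  have d2 : HasDerivAt (fun z : ℂ => z ^ 2 - 1) (2 * z) z := by
    simpa using (hasDerivAt_pow 2 z).sub_const 1
  have d := ((d1.const_mul (-Complex.exp (2 * Complex.I * θ))).mul d2)
  have d' : HasDerivAt (varpi θ a) _ z := d
  convert d' using 1
  unfold varpi
  field_simp
  ring

theorem inv_im_pos_of_im_neg (w : ℂ) (h : w.im < 0) : 0 < (w⁻¹).im := by
  rw [Complex.inv_im]
  have : 0 < Complex.normSq w := Complex.normSq_pos.2 (fun h' => by simp [h'] at h)
  exact div_pos (by linarith) this

/-- A short horizontal trajectory of `ϖ_{a,θ}` joining `z = 1` to `z = a` stays in the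
closed upper half-plane when `Im a > 0`. -/
theorem stmt19 (θ : ℝ) (hθ : θ ∈ Ico (0:ℝ) (Real.pi / 2))
    (a : ℂ) (ha : 0 < a.im)
    (γ γ' : ℝ → ℂ)
    (hc : ContinuousOn γ (Icc (0:ℝ) 1)) (h0 : γ 0 = 1) (h1 : γ 1 = a)
    (htraj : ∀ t ∈ Ioo (0:ℝ) 1,
      HasDerivAt γ (γ' t) t ∧ γ' t ≠ 0 ∧
      (γ t - a) * ((γ t) ^ 2 - 1) ≠ 0 ∧
      (varpi θ a (γ t) * (γ' t) ^ 2).im = 0 ∧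
      0 < (varpi θ a (γ t) * (γ' t) ^ 2).re) :
    ∀ t ∈ Icc (0:ℝ) 1, 0 ≤ (γ t).im := by
  by_contra! hcon
  obtain ⟨t₁, ht₁, hneg⟩ := hcon
  have hci : ContinuousOn (fun t => (γ t).im) (Icc (0:ℝ) 1) :=
    Complex.continuous_im.comp_continuousOn hc
  obtain ⟨t₀, ht₀, hmin⟩ := isCompact_Icc.exists_isMinOn ⟨t₁, ht₁⟩ hci
  have hmin' : ∀ t ∈ Icc (0:ℝ) 1, (γ t₀).im ≤ (γ t).im := fun t ht => hmin ht
  have hz : (γ t₀).im < 0 := lt_of_le_of_lt (hmin' t₁ ht₁) hneg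
  have hI : t₀ ∈ Ioo (0:ℝ) 1 := by
    refine ⟨lt_of_le_of_ne ht₀.1 ?_, lt_of_le_of_ne ht₀.2 ?_⟩
    · rintro rfl
      rw [h0] at hz; simp at hz
    · rintro rfl
      rw [h1] at hz; linarith
  have him : ∀ t ∈ Ioo (0:ℝ) 1, HasDerivAt (fun t => (γ t).im) (γ' t).im t := fun t ht =>
    Complex.imCLM.hasFDerivAt.comp_hasDerivAt t (htraj t ht).1
  have hre : ∀ t ∈ Ioo (0:ℝ) 1, HasDerivAt (fun t => (γ t).re) (γ' t).re t := fun t ht =>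
    Complex.reCLM.hasFDerivAt.comp_hasDerivAt t (htraj t ht).1
  have hIcc : Icc (0:ℝ) 1 ∈ nhds t₀ := Icc_mem_nhds hI.1 hI.2
  have hr0 : (γ' t₀).im = 0 := (hmin.isLocalMin hIcc).hasDerivAt_eq_zero (him t₀ hI)
  obtain ⟨hd, hne, hnz, hi0, hp0⟩ := htraj t₀ hI
  set r := (γ' t₀).re with hr
  have hγ' : γ' t₀ = (r : ℂ) := Complex.ext (by simp [hr]) (by simpa using hr0)
  have hrne : r ≠ 0 := fun h => hne (by rw [hγ', h]; simp)
  have hr2 : 0 < r ^ 2 := by positivity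
  rw [hγ', ← Complex.ofReal_pow] at hi0 hp0
  rw [Complex.im_mul_ofReal] at hi0
  rw [Complex.re_mul_ofReal] at hp0
  have hψi : (varpi θ a (γ t₀)).im = 0 := (mul_eq_zero.1 hi0).resolve_right hr2.ne'
  have hψr : 0 < (varpi θ a (γ t₀)).re := pos_of_mul_pos_left hp0 hr2.le
  have hψ : HasDerivAt (fun t => varpi θ a (γ t)) _ t₀ :=
    (varpi_hasDerivAt θ a (γ t₀) hnz).comp t₀ hd
  set L := (γ t₀ - a)⁻¹ + (γ t₀ - 1)⁻¹ + (γ t₀ + 1)⁻¹ with hL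
  have hLpos : 0 < L.im := by
    rw [hL, Complex.add_im, Complex.add_im]
    have e1 := inv_im_pos_of_im_neg (γ t₀ - a) (by simp; linarith)
    have e2 := inv_im_pos_of_im_neg (γ t₀ - 1) (by simpa using hz)
    have e3 := inv_im_pos_of_im_neg (γ t₀ + 1) (by simpa using hz)
    linarith
  have hψim : HasDerivAt (fun t => r * (varpi θ a (γ t)).im)
      (r * (varpi θ a (γ t₀) * L * γ' t₀).im) t₀ :=
    (Complex.imCLM.hasFDerivAt.comp_hasDerivAt t₀ hψ).const_mul r
  have hderpos : 0 < r * (varpi θ a (γ t₀) * L * γ' t₀).im := by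
    rw [hγ', Complex.im_mul_ofReal, Complex.mul_im, hψi]
    have : 0 < (varpi θ a (γ t₀)).re * L.im * r ^ 2 := by positivity
    nlinarith
  have ev1 : ∀ᶠ t in nhdsWithin t₀ (Ioi t₀), 0 < r * (varpi θ a (γ t)).im := by
    have hs := (hasDerivAt_iff_tendsto_slope.1 hψim).mono_left
      (nhdsWithin_mono t₀ (fun x (hx : t₀ < x) => hx.ne'))
    filter_upwards [hs.eventually (lt_mem_nhds hderpos), self_mem_nhdsWithin] with t ht ht'
    rw [slope_def_field, hψi, mul_zero, sub_zero] at ht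
    have ht'' : 0 < t - t₀ := sub_pos.2 ht'
    exact (div_pos_iff_of_pos_right ht'').1 ht
  have ev2 : ∀ᶠ t in nhdsWithin t₀ (Ioi t₀), 0 < (varpi θ a (γ t)).re :=
    ((Complex.continuous_re.continuousAt.comp hψ.continuousAt).eventually
      (lt_mem_nhds hψr)).filter_mono nhdsWithin_le_nhds
  have ev3 : ∀ᶠ t in nhdsWithin t₀ (Ioi t₀), t < 1 :=
    (gt_mem_nhds hI.2 : ∀ᶠ t in nhds t₀, t < 1).filter_mono nhdsWithin_le_nhds
  obtain ⟨u, hu, hsub⟩ := mem_nhdsGT_iff_exists_Ioo_subset.1 (ev1.and (ev2.and ev3))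
  have hu' : t₀ < u := hu
  have key : ∀ t ∈ Ioo t₀ u, (γ' t).re ≠ 0 ∧ r * ((γ' t).re * (γ' t).im) < 0 := by
    intro t ht
    obtain ⟨k1, k2, k3⟩ := hsub ht
    obtain ⟨-, -, -, m1, m2⟩ := htraj t ⟨hI.1.trans ht.1, k3⟩
    rw [pow_two] at m1 m2
    simp only [Complex.mul_im, Complex.mul_re] at m1 m2
    generalize (varpi θ a (γ t)).re = c at *
    generalize (varpi θ a (γ t)).im = d at *
    generalize (γ' t).re = x at *
    generalize (γ' t).im = y at *
    have hA : 0 < (c ^ 2 + d ^ 2) * (x * x - y * y) := by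
      have := mul_pos k2 m2
      have e : (c ^ 2 + d ^ 2) * (x * x - y * y)
        = c * (c * (x * x - y * y) - d * (x * y + y * x))
          + d * (c * (x * y + y * x) + d * (x * x - y * y)) := by ring
      rw [e, m1]; linarith
    have hA' : 0 < x * x - y * y := pos_of_mul_pos_right hA (by positivity)
    refine ⟨fun hx => ?_, ?_⟩
    · subst hx
      nlinarith [mul_self_nonneg y]
    · have hB : 2 * c * (r * (x * y)) = - ((r * d) * (x * x - y * y)) := by
        linear_combination r * m1
      have := mul_pos k1 hA'
      by_contra hcon
      have := mul_nonneg k2.le (not_lt.1 hcon)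
      linarith
  have hIco : ∀ t ∈ Ico t₀ u, t ∈ Ioo (0:ℝ) 1 := by
    intro t ht
    rcases eq_or_lt_of_le ht.1 with h | h
    · exact h ▸ hI
    · exact ⟨hI.1.trans h, (hsub ⟨h, ht.2⟩).2.2⟩
  have hsign : ∀ t ∈ Ioo t₀ u, 0 < r * (γ' t).re := by
    have D := hasDerivWithinAt_forall_lt_or_forall_gt_of_forall_ne (m := 0)
      (convex_Ico t₀ u) (f := fun t => r * (γ t).re) (f' := fun t => r * (γ' t).re)
      (fun t ht => ((hre t (hIco t ht)).const_mul r).hasDerivWithinAt)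
      (fun t ht => by
        rcases eq_or_lt_of_le ht.1 with h | h
        · subst h
          exact mul_ne_zero hrne hrne
        · exact mul_ne_zero hrne (key t ⟨h, ht.2⟩).1)
    rcases D with D | D
    · have := D t₀ ⟨le_rfl, hu'⟩
      simp only [← hr] at this
      nlinarith
    · exact fun t ht => D t ⟨ht.1.le, ht.2⟩
  obtain ⟨v, hv1, hv2⟩ := exists_between hu'
  have hvI : v ∈ Ioo (0:ℝ) 1 := hIco v ⟨hv1.le, hv2⟩
  obtain ⟨ξ, hξ, hξe⟩ := exists_hasDerivAt_eq_slope (fun t => (γ t).im) (fun t => (γ' t).im) hv1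
    (hci.mono (Icc_subset_Icc hI.1.le hvI.2.le))
    (fun t ht => him t (hIco t ⟨ht.1.le, ht.2.trans hv2⟩))
  have hξ' : ξ ∈ Ioo t₀ u := ⟨hξ.1, hξ.2.trans hv2⟩
  have q1 := (key ξ hξ').2
  have q2 := hsign ξ hξ'
  have q3 : 0 ≤ (γ' ξ).im := by
    rw [hξe]
    exact div_nonneg (sub_nonneg.2 (hmin' v ⟨hvI.1.le, hvI.2.le⟩)) (sub_nonneg.2 hv1.le)
  have := mul_nonneg q2.le q3
  linarith
end
end
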